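/- arXiv:1306.3674 — 3 statements merged into one kernel-verified Lean document; each statement's English description precedes it below -/
import Mathlib

section
/- There exist absolute constants 0 < c ≤ C < ∞ such that for every integer n≥2 and every real q with 0 < q ≤ 1/n, if π is distributed according to the (n,q)-Mallows measure, then c·nq ≤ E(LDS(π)) − 1 ≤ C·nq. -/
open Finset

/-- Number of inversions of a permutation of `Fin n`. -/
def mallowsInv {n : ℕ} (π : Equiv.Perm (Fin n)) : ℕ :=
  (Finset.univ.filter (fun p : Fin n × Fin n => p.1 < p.2 ∧ π p.2 < π p.1)).card

/-- The `(n,q)`-Mallows probability mass function on `S_n`. -/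
noncomputable def mallowsPMF (n : ℕ) (q : ℝ) (π : Equiv.Perm (Fin n)) : ℝ :=
  q ^ mallowsInv π / ∑ σ : Equiv.Perm (Fin n), q ^ mallowsInv σ

/-- Probability of an event under the `(n,q)`-Mallows measure. -/
noncomputable def mallowsProb (n : ℕ) (q : ℝ) (A : Set (Equiv.Perm (Fin n))) : ℝ :=
  ∑ π : Equiv.Perm (Fin n), A.indicator (mallowsPMF n q) π

/-- Expectation of a function under the `(n,q)`-Mallows measure. -/
noncomputable def mallowsExp (n : ℕ) (q : ℝ) (f : Equiv.Perm (Fin n) → ℝ) : ℝ :=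
  ∑ π : Equiv.Perm (Fin n), mallowsPMF n q π * f π

/-- Length of the longest increasing subsequence of a permutation of `Fin n`. -/
noncomputable def LIS {n : ℕ} (π : Equiv.Perm (Fin n)) : ℕ :=
  sSup {m | ∃ f : Fin m → Fin n, StrictMono f ∧ StrictMono (fun j => π (f j))}

/-- Length of the longest decreasing subsequence of a permutation of `Fin n`. -/
noncomputable def LDS {n : ℕ} (π : Equiv.Perm (Fin n)) : ℕ :=
  sSup {m | ∃ f : Fin m → Fin n, StrictMono f ∧ StrictAnti (fun j => π (f j))}

/-- The positions of the descents of a permutation of `Fin (N + 1)`. -/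
def descents {N : ℕ} (π : Equiv.Perm (Fin (N + 1))) : Finset (Fin N) :=
  Finset.univ.filter (fun i => π i.succ < π i.castSucc)

theorem mem_descents {N : ℕ} {π : Equiv.Perm (Fin (N + 1))} {i : Fin N} :
    i ∈ descents π ↔ π i.succ < π i.castSucc := by
  simp [descents]

theorem exists_descent_between {N : ℕ} (π : Equiv.Perm (Fin (N + 1))) {a b : Fin (N + 1)}
    (hab : a < b) (h : π b < π a) :
    ∃ i : Fin N, a ≤ i.castSucc ∧ i.castSucc < b ∧ i ∈ descents π := by
  by_contra! hc
  have key : ∀ k : ℕ, (a : ℕ) ≤ k → ∀ hk : k < N + 1, k ≤ b → π a ≤ π ⟨k, hk⟩ := by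
    intro k hak
    induction k, hak using Nat.le_induction with
    | base => intro _ _; exact le_rfl
    | succ k hak ih =>
      intro hk hkb
      have hkN : k < N := by omega
      have h1 := ih (by omega) (by omega)
      have h2 := hc ⟨k, hkN⟩ (by simpa [Fin.le_def] using hak)
        (by simp only [Fin.lt_def, Fin.val_castSucc]; omega)
      rw [mem_descents, not_lt] at h2
      exact h1.trans h2
  exact absurd (key b hab.le b.isLt le_rfl) (not_le.mpr h)

theorem length_le_card_descents_add_one {N : ℕ} (π : Equiv.Perm (Fin (N + 1))) {m : ℕ}
    {f : Fin m → Fin (N + 1)} (hf : StrictMono f) (hπ : StrictAnti (fun j => π (f j))) :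
    m ≤ (descents π).card + 1 := by
  cases m with
  | zero => omega
  | succ m =>
    have hex : ∀ j : Fin m, ∃ i : Fin N, f j.castSucc ≤ i.castSucc ∧ i.castSucc < f j.succ ∧
        i ∈ descents π := fun j =>
      exists_descent_between π (hf j.castSucc_lt_succ) (hπ j.castSucc_lt_succ)
    choose g hg1 hg2 hg3 using hex
    have hg : StrictMono g := by
      intro j k hjk
      have h : f j.succ ≤ f k.castSucc := hf.monotone (by
        simp only [Fin.le_def, Fin.val_succ, Fin.val_castSucc]; exact hjk)
      exact Fin.castSucc_lt_castSucc_iff.mp (((hg2 j).trans_le h).trans_le (hg1 k))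
    have h := Finset.card_le_card_of_injOn (s := Finset.univ) g (fun j _ => hg3 j)
      hg.injective.injOn
    simpa using h

theorem LDS_le_card_descents_add_one {N : ℕ} (π : Equiv.Perm (Fin (N + 1))) :
    LDS π ≤ (descents π).card + 1 :=
  csSup_le ⟨0, Fin.elim0, fun i => i.elim0, fun i => i.elim0⟩
    fun _ ⟨_, hf, hπ⟩ => length_le_card_descents_add_one π hf hπ

theorem length_le_LDS {N : ℕ} (π : Equiv.Perm (Fin (N + 1))) {m : ℕ}
    {f : Fin m → Fin (N + 1)} (hf : StrictMono f) (hπ : StrictAnti (fun j => π (f j))) :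
    m ≤ LDS π :=
  le_csSup ⟨(descents π).card + 1,
    fun _ ⟨_, hf, hπ⟩ => length_le_card_descents_add_one π hf hπ⟩ ⟨f, hf, hπ⟩

theorem one_le_LDS {N : ℕ} (π : Equiv.Perm (Fin (N + 1))) : 1 ≤ LDS π :=
  length_le_LDS π (f := fun _ : Fin 1 => 0) (Subsingleton.strictMono _)
    (Subsingleton.strictAnti _)

theorem two_le_LDS {N : ℕ} {π : Equiv.Perm (Fin (N + 1))} (hπ : π ≠ 1) : 2 ≤ LDS π := by
  obtain ⟨i, hi⟩ : ∃ i : Fin N, π i.succ < π i.castSucc := by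
    by_contra! hc
    have hmono : StrictMono π :=
      (Fin.monotone_iff_le_succ.mpr hc).strictMono_of_injective π.injective
    refine hπ (Equiv.ext fun x => ?_)
    exact congrFun ((hmono.range_inj strictMono_id).mp (by simp)) x
  refine length_le_LDS π (f := ![i.castSucc, i.succ]) ?_ ?_
  · rw [Fin.strictMono_iff_lt_succ]
    simp [i.castSucc_lt_succ]
  · rw [Fin.strictAnti_iff_succ_lt]
    simpa using hi

theorem mallowsInv_one {n : ℕ} : mallowsInv (1 : Equiv.Perm (Fin n)) = 0 := by
  simp only [mallowsInv, Finset.card_eq_zero, Finset.filter_eq_empty_iff]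
  rintro p - ⟨h1, h2⟩
  exact lt_asymm h1 h2

theorem swap_succ_lt_swap_succ {N : ℕ} (i : Fin N) {a b : Fin (N + 1)} (hab : a < b)
    (hne : ¬ (a = i.castSucc ∧ b = i.succ)) :
    Equiv.swap i.castSucc i.succ a < Equiv.swap i.castSucc i.succ b := by
  simp only [Equiv.swap_apply_def]
  split_ifs <;> simp only [Fin.ext_iff, Fin.lt_def, Fin.val_castSucc, Fin.val_succ] at * <;> omega

theorem mallowsInv_mul_swap {N : ℕ} (π : Equiv.Perm (Fin (N + 1))) (i : Fin N)
    (h : π i.castSucc < π i.succ) :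
    mallowsInv (π * Equiv.swap i.castSucc i.succ) = mallowsInv π + 1 := by
  set s := Equiv.swap i.castSucc i.succ with hs
  have hss : ∀ x, s (s x) = x := Equiv.swap_apply_self _ _
  have hlt : i.castSucc < i.succ := i.castSucc_lt_succ
  have hset : (Finset.univ.filter (fun p : Fin (N + 1) × Fin (N + 1) =>
      p.1 < p.2 ∧ (π * s) p.2 < (π * s) p.1)) =
      insert (i.castSucc, i.succ)
        ((Finset.univ.filter (fun p : Fin (N + 1) × Fin (N + 1) =>
          p.1 < p.2 ∧ π p.2 < π p.1)).map (s.prodCongr s).toEmbedding) := by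
    ext ⟨a, b⟩
    rw [Finset.mem_filter, Finset.mem_insert, Finset.mem_map]
    simp only [Finset.mem_filter, Finset.mem_univ, true_and, Equiv.Perm.mul_apply, Prod.mk.injEq, Equiv.coe_toEmbedding, Equiv.prodCongr_apply,
      Prod.exists, Prod.map_apply]
    constructor
    · rintro ⟨hab, hinv⟩
      by_cases hne : a = i.castSucc ∧ b = i.succ
      · exact Or.inl hne
      · exact Or.inr ⟨s a, s b, ⟨swap_succ_lt_swap_succ i hab hne, hinv⟩, hss a, hss b⟩
    · rintro (⟨rfl, rfl⟩ | ⟨c, d, ⟨hcd, hinv⟩, rfl, rfl⟩)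
      · exact ⟨hlt, by simpa [hs] using h⟩
      · refine ⟨swap_succ_lt_swap_succ i hcd ?_, by simpa [hss] using hinv⟩
        rintro ⟨rfl, rfl⟩
        exact lt_asymm h hinv
  rw [mallowsInv, hset, Finset.card_insert_of_notMem, Finset.card_map, mallowsInv]
  simp only [Finset.mem_filter, Finset.mem_univ, true_and, Finset.mem_map, Prod.mk.injEq,
    Equiv.coe_toEmbedding, Equiv.prodCongr_apply, Prod.exists, Prod.map_apply, not_exists, not_and]
  intro c d hcd h1 h2
  have hc : c = i.succ := by rw [← hss c, h1, hs, Equiv.swap_apply_left]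
  have hd : d = i.castSucc := by rw [← hss d, h2, hs, Equiv.swap_apply_right]
  exact lt_asymm hlt (hc ▸ hd ▸ hcd.1)

/-- The Mallows weight of having a descent at a given position is at most `q` times the
total weight. -/
theorem sum_descent_weight_le {N : ℕ} {q : ℝ} (hq : 0 < q) (i : Fin N) :
    ∑ π : Equiv.Perm (Fin (N + 1)), (if i ∈ descents π then q ^ mallowsInv π else 0) ≤
      q * ∑ π : Equiv.Perm (Fin (N + 1)), q ^ mallowsInv π := by
  rw [← Equiv.sum_comp (Equiv.mulRight (Equiv.swap i.castSucc i.succ)), Finset.mul_sum]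
  refine Finset.sum_le_sum fun π _ => ?_
  split_ifs with h
  · simp only [mem_descents, Equiv.coe_mulRight, Equiv.Perm.mul_apply, Equiv.swap_apply_left,
      Equiv.swap_apply_right] at h
    rw [Equiv.coe_mulRight, mallowsInv_mul_swap π i h, pow_succ']
  · positivity

theorem sum_card_descents_weight_le {N : ℕ} {q : ℝ} (hq : 0 < q) :
    ∑ π : Equiv.Perm (Fin (N + 1)), q ^ mallowsInv π * ((descents π).card : ℝ) ≤
      N * q * ∑ π : Equiv.Perm (Fin (N + 1)), q ^ mallowsInv π := by
  calc ∑ π : Equiv.Perm (Fin (N + 1)), q ^ mallowsInv π * ((descents π).card : ℝ)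
      = ∑ i : Fin N, ∑ π : Equiv.Perm (Fin (N + 1)),
          (if i ∈ descents π then q ^ mallowsInv π else 0) := by
        rw [Finset.sum_comm]
        refine Finset.sum_congr rfl fun π _ => ?_
        rw [Finset.sum_ite_mem, Finset.univ_inter, Finset.sum_const, nsmul_eq_mul, mul_comm]
    _ ≤ ∑ _i : Fin N, q * ∑ π : Equiv.Perm (Fin (N + 1)), q ^ mallowsInv π :=
        Finset.sum_le_sum fun i _ => sum_descent_weight_le hq i
    _ = _ := by rw [Finset.sum_const, Finset.card_univ, Fintype.card_fin, nsmul_eq_mul]; ring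

theorem swap_succ_injective {N : ℕ} :
    Function.Injective (fun i : Fin N => Equiv.swap i.castSucc i.succ) := by
  intro i j hij
  by_contra hne
  have h := DFunLike.congr_fun hij i.castSucc
  simp only [Equiv.swap_apply_left, Equiv.swap_apply_def] at h
  split_ifs at h <;> simp only [Fin.ext_iff, Fin.val_castSucc, Fin.val_succ] at * <;> omega

/-- The identity and the adjacent transpositions contribute `1 + N q` to the partition function. -/
theorem one_add_mul_le_partition {N : ℕ} {q : ℝ} (hq : 0 < q) :
    1 + N * q ≤ ∑ π : Equiv.Perm (Fin (N + 1)), q ^ mallowsInv π := by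
  have hinv : ∀ i : Fin N, mallowsInv (Equiv.swap i.castSucc i.succ) = 1 := fun i => by
    simpa [mallowsInv_one] using mallowsInv_mul_swap 1 i i.castSucc_lt_succ
  have hnot : (1 : Equiv.Perm (Fin (N + 1))) ∉
      Finset.univ.map ⟨fun i : Fin N => Equiv.swap i.castSucc i.succ, swap_succ_injective⟩ := by
    simp only [Finset.mem_map, Finset.mem_univ, true_and, Function.Embedding.coeFn_mk, not_exists]
    intro i hi
    have := hinv i
    rw [hi, mallowsInv_one] at this
    omega
  refine le_trans (le_of_eq ?_) (Finset.sum_le_univ_sum_of_nonneg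
    (s := insert 1 (Finset.univ.map
      ⟨fun i : Fin N => Equiv.swap i.castSucc i.succ, swap_succ_injective⟩))
    fun π => by positivity)
  rw [Finset.sum_insert hnot, Finset.sum_map]
  simp [hinv, mallowsInv_one]

theorem partition_pos {n : ℕ} {q : ℝ} (hq : 0 < q) :
    0 < ∑ π : Equiv.Perm (Fin n), q ^ mallowsInv π :=
  Finset.sum_pos (fun _ _ => by positivity) Finset.univ_nonempty

theorem mallowsExp_eq_div (n : ℕ) (q : ℝ) (f : Equiv.Perm (Fin n) → ℝ) :
    mallowsExp n q f = (∑ π : Equiv.Perm (Fin n), q ^ mallowsInv π * f π) /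
      ∑ π : Equiv.Perm (Fin n), q ^ mallowsInv π := by
  simp only [mallowsExp, mallowsPMF, Finset.sum_div]
  exact Finset.sum_congr rfl fun π _ => by ring

theorem mallowsExp_LDS_sub_one_le {N : ℕ} {q : ℝ} (hq : 0 < q) :
    mallowsExp (N + 1) q (fun π => (LDS π : ℝ)) - 1 ≤ N * q := by
  have hZ := partition_pos (n := N + 1) hq
  rw [mallowsExp_eq_div, sub_le_iff_le_add, div_le_iff₀ hZ]
  calc ∑ π : Equiv.Perm (Fin (N + 1)), q ^ mallowsInv π * (LDS π : ℝ)
      ≤ ∑ π : Equiv.Perm (Fin (N + 1)), q ^ mallowsInv π * ((descents π).card + 1 : ℝ) := by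
        refine Finset.sum_le_sum fun π _ => mul_le_mul_of_nonneg_left ?_ (by positivity)
        exact_mod_cast LDS_le_card_descents_add_one π
    _ ≤ _ := by
        simp only [mul_add, mul_one, Finset.sum_add_distrib]
        linarith [sum_card_descents_weight_le (N := N) hq]

theorem le_mallowsExp_LDS_sub_one {N : ℕ} {q : ℝ} (hq : 0 < q) :
    N * q / (1 + N * q) ≤ mallowsExp (N + 1) q (fun π => (LDS π : ℝ)) - 1 := by
  have hZ := partition_pos (n := N + 1) hq
  have hNZ := one_add_mul_le_partition (N := N) hq
  have hNq : 0 < 1 + N * q := by positivity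
  rw [mallowsExp_eq_div, le_sub_iff_add_le, le_div_iff₀ hZ]
  set Z := ∑ π : Equiv.Perm (Fin (N + 1)), q ^ mallowsInv π with hZdef
  have hsum : 2 * Z - 1 ≤ ∑ π : Equiv.Perm (Fin (N + 1)), q ^ mallowsInv π * (LDS π : ℝ) := by
    have : 2 * Z - 1 = ∑ π : Equiv.Perm (Fin (N + 1)),
        (2 * q ^ mallowsInv π - if π = 1 then 1 else 0) := by
      rw [Finset.sum_sub_distrib, ← Finset.mul_sum, Finset.sum_ite_eq']
      simp [hZdef]
    rw [this]
    refine Finset.sum_le_sum fun π _ => ?_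
    split_ifs with h
    · subst h
      have : (1 : ℝ) ≤ LDS (1 : Equiv.Perm (Fin (N + 1))) := by exact_mod_cast one_le_LDS _
      rw [mallowsInv_one]
      linarith
    · have : (2 : ℝ) ≤ LDS π := by exact_mod_cast two_le_LDS h
      have := mul_le_mul_of_nonneg_left this (pow_pos hq (mallowsInv π)).le
      linarith
  refine le_trans ?_ hsum
  have h1 : N * q / (1 + N * q) = 1 - 1 / (1 + N * q) := by field_simp; ring
  have h2 : 1 ≤ 1 / (1 + N * q) * Z := by
    rw [div_mul_eq_mul_div, one_mul, one_le_div hNq]; exact hNZ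
  rw [h1]
  linarith

/-- There are absolute constants `0 < c ≤ C < ∞` so that for `n≥2` and
`0 < q ≤ 1/n`, if `π ~ μ_{n,q}` then `c·nq ≤ E(LDS(π)) − 1 ≤ C·nq`. -/
theorem mallows_expected_LDS_very_small_q :
    ∃ c C : ℝ, 0 < c ∧ c ≤ C ∧
      ∀ (n : ℕ) (q : ℝ), 2 ≤ n → 0 < q → q ≤ 1 / (n : ℝ) →
        c * ((n : ℝ) * q) ≤ mallowsExp n q (fun π => (LDS π : ℝ)) - 1 ∧
        mallowsExp n q (fun π => (LDS π : ℝ)) - 1 ≤ C * ((n : ℝ) * q) := by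
  refine ⟨1 / 4, 1, by norm_num, by norm_num, fun n q hn hq hqn => ?_⟩
  obtain ⟨N, rfl⟩ : ∃ N, n = N + 1 := ⟨n - 1, by omega⟩
  have hN : (1 : ℝ) ≤ N := by exact_mod_cast (by omega : 1 ≤ N)
  rw [le_div_iff₀ (by positivity)] at hqn
  push_cast at *
  constructor
  · refine le_trans ?_ (le_mallowsExp_LDS_sub_one hq)
    rw [le_div_iff₀ (by positivity)]
    have h1 : (1 : ℝ) + N * q ≤ 2 := by linarith
    have h2 : q ≤ N * q := le_mul_of_one_le_left hq.le hN
    nlinarith [mul_le_mul_of_nonneg_left h1 (by positivity : (0 : ℝ) ≤ (N + 1) * q)]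
  · linarith [mallowsExp_LDS_sub_one_le (N := N) hq]
end

section
/- There exists an absolute constant C > 0 such that for every integer n≥2, every real q with 0 < q < 1 − 2/n, and every integer L ≥ 2, if π is distributed according to the (n,q)-Mallows measure, then: if L ≤ 3/(1−q) then P(LDS(π) ≥ L) ≤ n^8·(C/((1−q)L²))^L, and if L > 3/(1−q) then P(LDS(π) ≥ L) ≤ n^8·(C(1−q))^L·q^{L(L−1)/2}. -/
open Finset

/-- The permutation with first value `c` whose remaining values have the pattern `τ`. -/
def consPerm {M : ℕ} (c : Fin (M + 1)) (τ : Equiv.Perm (Fin M)) : Equiv.Perm (Fin (M + 1)) :=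
  (Equiv.Perm.decomposeFin.symm (0, τ)).trans c.cycleRange.symm

@[simp] lemma consPerm_zero {M : ℕ} (c : Fin (M + 1)) (τ : Equiv.Perm (Fin M)) :
    consPerm c τ 0 = c := by
  simp [consPerm]

@[simp] lemma consPerm_succ {M : ℕ} (c : Fin (M + 1)) (τ : Equiv.Perm (Fin M)) (i : Fin M) :
    consPerm c τ i.succ = c.succAbove (τ i) := by
  simp [consPerm]

lemma consPerm_bijective (M : ℕ) :
    Function.Bijective (fun x : Fin (M + 1) × Equiv.Perm (Fin M) => consPerm x.1 x.2) := by
  rw [Fintype.bijective_iff_injective_and_card]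
  refine ⟨?_, ?_⟩
  · rintro ⟨c, τ⟩ ⟨d, σ⟩ h
    have h0 : c = d := by simpa using DFunLike.congr_fun h 0
    subst h0
    have : τ = σ := by
      ext i
      have := DFunLike.congr_fun h i.succ
      simp only [consPerm_succ] at this
      rw [Fin.succAbove_right_injective this]
    rw [this]
  · simp [Fintype.card_perm, Nat.factorial_succ]

lemma mallowsInv_eq_sum {M : ℕ} (π : Equiv.Perm (Fin M)) :
    mallowsInv π = ∑ i, ∑ j, if i < j ∧ π j < π i then 1 else 0 := by
  rw [mallowsInv, Finset.card_filter, Fintype.sum_prod_type]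

lemma mallowsInv_consPerm {M : ℕ} (c : Fin (M + 1)) (τ : Equiv.Perm (Fin M)) :
    mallowsInv (consPerm c τ) = c + mallowsInv τ := by
  rw [mallowsInv_eq_sum, mallowsInv_eq_sum, Fin.sum_univ_succ]
  congr 1
  · rw [Fin.sum_univ_succ]
    simp only [lt_self_iff_false, false_and, if_false, zero_add, Fin.succ_pos, true_and,
      consPerm_zero, consPerm_succ]
    rw [Equiv.sum_comp τ (fun y => if c.succAbove y < c then 1 else 0)]
    simp only [Fin.succAbove_lt_iff_castSucc_lt]
    simp only [Fin.lt_def, Fin.val_castSucc]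
    rw [Fin.sum_univ_eq_sum_range (fun y => if y < (c : ℕ) then 1 else 0) M]
    rw [← Finset.card_filter]
    have : (Finset.range M).filter (fun y => y < (c : ℕ)) = Finset.range c := by
      ext y; simp; omega
    rw [this, Finset.card_range]
  · refine Finset.sum_congr rfl fun i _ => ?_
    rw [Fin.sum_univ_succ]
    simp

lemma mallowsInv_conj_rev {M : ℕ} (π : Equiv.Perm (Fin M)) :
    mallowsInv ((Fin.revPerm.trans π).trans Fin.revPerm) = mallowsInv π := by
  rw [mallowsInv_eq_sum, mallowsInv_eq_sum, Finset.sum_comm]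
  rw [← Equiv.sum_comp Fin.revPerm]
  refine Finset.sum_congr rfl fun i _ => ?_
  rw [← Equiv.sum_comp Fin.revPerm]
  refine Finset.sum_congr rfl fun j _ => ?_
  simp

lemma sum_perm_succ {M : ℕ} (g : Equiv.Perm (Fin (M + 1)) → ℝ) :
    ∑ σ, g σ = ∑ c : Fin (M + 1), ∑ τ : Equiv.Perm (Fin M), g (consPerm c τ) := by
  rw [← Fintype.sum_prod_type']
  exact ((consPerm_bijective M).sum_comp g).symm

lemma mallows_norm_pos (M : ℕ) {q : ℝ} (hq : 0 < q) :
    0 < ∑ σ : Equiv.Perm (Fin M), q ^ mallowsInv σ :=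
  Finset.sum_pos (fun _ _ => pow_pos hq _) Finset.univ_nonempty

lemma mallowsPMF_nonneg {M : ℕ} {q : ℝ} (hq : 0 < q) (σ : Equiv.Perm (Fin M)) :
    0 ≤ mallowsPMF M q σ :=
  div_nonneg (pow_pos hq _).le (mallows_norm_pos M hq).le

lemma mallowsPMF_consPerm {M : ℕ} {q : ℝ} (hq : 0 < q) (hq1 : q < 1) (c : Fin (M + 1))
    (τ : Equiv.Perm (Fin M)) :
    mallowsPMF (M + 1) q (consPerm c τ) =
      (1 - q) * q ^ (c : ℕ) / (1 - q ^ (M + 1)) * mallowsPMF M q τ := by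
  have hZ : ∑ σ : Equiv.Perm (Fin (M + 1)), q ^ mallowsInv σ =
      (1 - q ^ (M + 1)) / (1 - q) * ∑ σ : Equiv.Perm (Fin M), q ^ mallowsInv σ := by
    rw [sum_perm_succ]
    simp only [mallowsInv_consPerm, pow_add, ← Finset.mul_sum]
    rw [← Finset.sum_mul, Fin.sum_univ_eq_sum_range (fun y => q ^ y), geom_sum_eq hq1.ne,
      ← neg_div_neg_eq]
    ring
  have h1 : (1 : ℝ) - q ≠ 0 := by linarith
  have h2 : (1 : ℝ) - q ^ (M + 1) ≠ 0 := (sub_pos.2 (pow_lt_one₀ hq.le hq1 (by simp))).ne'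
  have h3 := (mallows_norm_pos M hq).ne'
  rw [mallowsPMF, mallowsPMF, hZ, mallowsInv_consPerm]
  field_simp
  ring

lemma mallowsProb_mono {M : ℕ} {q : ℝ} (hq : 0 < q) {A B : Set (Equiv.Perm (Fin M))}
    (h : A ⊆ B) : mallowsProb M q A ≤ mallowsProb M q B :=
  Finset.sum_le_sum fun σ _ =>
    Set.indicator_le_indicator_of_subset h (fun σ => mallowsPMF_nonneg hq σ) σ

lemma mallowsProb_nonneg {M : ℕ} {q : ℝ} (hq : 0 < q) (A : Set (Equiv.Perm (Fin M))) :
    0 ≤ mallowsProb M q A :=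
  Finset.sum_nonneg fun σ _ => Set.indicator_nonneg (fun σ _ => mallowsPMF_nonneg hq σ) σ

lemma mallowsProb_union_le {M : ℕ} {q : ℝ} (hq : 0 < q) (A B : Set (Equiv.Perm (Fin M))) :
    mallowsProb M q (A ∪ B) ≤ mallowsProb M q A + mallowsProb M q B := by
  classical
  rw [mallowsProb, mallowsProb, mallowsProb, ← Finset.sum_add_distrib]
  refine Finset.sum_le_sum fun σ _ => ?_
  have := mallowsPMF_nonneg hq σ
  by_cases hA : σ ∈ A <;> by_cases hB : σ ∈ B <;> simp [hA, hB, this]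

lemma mallowsProb_le_one {M : ℕ} {q : ℝ} (hq : 0 < q) (A : Set (Equiv.Perm (Fin M))) :
    mallowsProb M q A ≤ 1 := by
  refine (mallowsProb_mono hq (Set.subset_univ A)).trans ?_
  simp only [mallowsProb, Set.indicator_univ, mallowsPMF]
  rw [← Finset.sum_div, div_self (mallows_norm_pos M hq).ne']

lemma mallowsProb_succ {M : ℕ} {q : ℝ} (hq : 0 < q) (hq1 : q < 1)
    (A : Set (Equiv.Perm (Fin (M + 1)))) :
    mallowsProb (M + 1) q A =
      ∑ c : Fin (M + 1), (1 - q) * q ^ (c : ℕ) / (1 - q ^ (M + 1)) *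
        mallowsProb M q {τ | consPerm c τ ∈ A} := by
  classical
  rw [mallowsProb, sum_perm_succ]
  refine Finset.sum_congr rfl fun c _ => ?_
  rw [mallowsProb, Finset.mul_sum]
  refine Finset.sum_congr rfl fun τ _ => ?_
  simp only [Set.indicator_apply, mallowsPMF_consPerm hq hq1, Set.mem_ofPred_eq, mul_ite, mul_zero]

lemma mallowsProb_conj_rev {M : ℕ} (q : ℝ) (A : Set (Equiv.Perm (Fin M))) :
    mallowsProb M q {π | (Fin.revPerm.trans π).trans Fin.revPerm ∈ A} = mallowsProb M q A := by
  classical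
  let e : Equiv.Perm (Equiv.Perm (Fin M)) :=
    Function.Involutive.toPerm (fun π => (Fin.revPerm.trans π).trans Fin.revPerm)
      (fun π => by ext i; simp)
  rw [mallowsProb, mallowsProb, ← Equiv.sum_comp e]
  refine Finset.sum_congr rfl fun π _ => ?_
  have he : ∀ π, e π = (Fin.revPerm.trans π).trans Fin.revPerm := fun π => rfl
  have h2 : mallowsPMF M q ((Fin.revPerm.trans π).trans Fin.revPerm) = mallowsPMF M q π := by
    rw [mallowsPMF, mallowsPMF, mallowsInv_conj_rev]
  have h3 : (Fin.revPerm.trans ((Fin.revPerm.trans π).trans Fin.revPerm)).trans Fin.revPerm = π := by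
    ext i; simp
  simp only [Set.indicator_apply, Set.mem_ofPred_eq, he, h2, h3]

/-- `π` has a decreasing subsequence of length `k` among its first `m` positions with values
below `R`. -/
def HasDec {M : ℕ} (π : Equiv.Perm (Fin M)) (k m R : ℕ) : Prop :=
  ∃ f : Fin k → Fin M, StrictMono f ∧ StrictAnti (fun j => π (f j)) ∧
    ∀ j, (f j : ℕ) < m ∧ (π (f j) : ℕ) < R

/-- `π` has a decreasing subsequence of length `k` among its last `m` positions. -/
def HasDecLast {M : ℕ} (π : Equiv.Perm (Fin M)) (k m : ℕ) : Prop :=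
  ∃ f : Fin k → Fin M, StrictMono f ∧ StrictAnti (fun j => π (f j)) ∧ ∀ j, M ≤ (f j : ℕ) + m

lemma hasDecLast_of_le_LDS {M L : ℕ} {π : Equiv.Perm (Fin M)} (h : L ≤ LDS π) :
    HasDecLast π L M := by
  have hmem := Nat.sSup_mem
    (s := {m | ∃ f : Fin m → Fin M, StrictMono f ∧ StrictAnti (fun j => π (f j))})
    ⟨0, Fin.elim0, fun i => i.elim0, fun i => i.elim0⟩
    ⟨M, by
      rintro m ⟨f, hf, -⟩
      simpa using Fintype.card_le_of_injective f hf.injective⟩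
  obtain ⟨f, hf, hf'⟩ := hmem
  refine ⟨fun j => f (Fin.castLE h j), fun i j hij => hf ?_, fun i j hij => hf' ?_, ?_⟩
  · exact hij
  · exact hij
  · intro j; omega

lemma HasDecLast.consPerm {M k m : ℕ} {τ : Equiv.Perm (Fin M)} (h : HasDecLast τ k m)
    (c : Fin (M + 1)) : HasDecLast (consPerm c τ) k m := by
  obtain ⟨f, hf, hf', hm⟩ := h
  refine ⟨fun j => (f j).succ, fun i j hij => ?_, fun i j hij => ?_, fun j => ?_⟩
  · simpa using hf hij
  · simpa using hf' hij
  · have := hm j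
    simp only [Fin.val_succ]
    omega

lemma HasDecLast.conj_rev {M k m : ℕ} {π : Equiv.Perm (Fin M)} (h : HasDecLast π k m) :
    HasDec ((Fin.revPerm.trans π).trans Fin.revPerm) k m M := by
  obtain ⟨f, hf, hf', hm⟩ := h
  refine ⟨fun j => (f j.rev).rev, fun i j hij => ?_, fun i j hij => ?_, fun j => ⟨?_, ?_⟩⟩
  · simpa using hf (Fin.rev_lt_rev.2 hij)
  · simpa using hf' (Fin.rev_lt_rev.2 hij)
  · have := hm j.rev
    rw [Fin.val_rev]
    omega
  · exact Fin.is_lt _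

lemma hasDec_of_succ {M k m R S : ℕ} {c : Fin (M + 1)} {τ : Equiv.Perm (Fin M)}
    {f : Fin k → Fin (M + 1)} (hf : StrictMono f)
    (hf' : StrictAnti (fun j => consPerm c τ (f j))) (hm : ∀ j, (f j : ℕ) < m + 1)
    (h0 : ∀ j, f j ≠ 0) (hR : ∀ j, (consPerm c τ (f j) : ℕ) < R)
    (hS : ∀ x : Fin M, (c.succAbove x : ℕ) < R → (x : ℕ) < S) : HasDec τ k m S := by
  choose g hg using fun j => Fin.exists_succ_eq.2 (h0 j)
  obtain rfl : (fun j => (g j).succ) = f := funext hg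
  refine ⟨g, fun i j hij => by simpa using hf hij, fun i j hij => by simpa using hf' hij,
    fun j => ⟨by simpa using hm j, hS _ (by simpa using hR j)⟩⟩

lemma HasDec.of_consPerm {M k m R : ℕ} {c : Fin (M + 1)} {τ : Equiv.Perm (Fin M)}
    (h : HasDec (consPerm c τ) (k + 1) (m + 1) R) :
    ((c : ℕ) < R ∧ (HasDec τ (k + 1) m (R - 1) ∨ HasDec τ k m c)) ∨
      (R ≤ c ∧ HasDec τ (k + 1) m R) := by
  obtain ⟨f, hf, hf', hmR⟩ := h
  by_cases h0 : f 0 = 0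
  · left
    have hc := (hmR 0).2
    rw [h0, consPerm_zero] at hc
    refine ⟨hc, Or.inr ?_⟩
    refine hasDec_of_succ (f := fun j => f j.succ) (c := c) (R := c) (fun i j hij => hf (by simpa))
      (fun i j hij => hf' (by simpa)) (fun j => (hmR _).1) (fun j hj => ?_) (fun j => ?_)
      (fun x hx => ?_)
    · have := hf (Fin.succ_pos j)
      rw [hj] at this
      simp at this
    · have := hf' (Fin.succ_pos j)
      simp only [h0, consPerm_zero] at this
      exact this
    · have : c.succAbove x < c := hx
      rw [Fin.succAbove_lt_iff_castSucc_lt] at this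
      exact this
  · have h1 : ∀ j, f j ≠ 0 := fun j hj => h0 <| by
      have := hf.monotone (Fin.zero_le j)
      rw [hj] at this
      exact Fin.le_zero_iff.1 this
    rcases lt_or_ge (c : ℕ) R with hc | hc
    · left
      refine ⟨hc, Or.inl ?_⟩
      refine hasDec_of_succ hf hf' (fun j => (hmR _).1) h1 (fun j => (hmR j).2) (fun x hx => ?_)
      rcases Fin.castSucc_lt_or_lt_succ c x with h | h
      · have : (x : ℕ) < c := h
        omega
      · rw [Fin.succAbove_of_lt_succ _ _ h, Fin.val_succ] at hx
        omega
    · right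
      refine ⟨hc, ?_⟩
      refine hasDec_of_succ hf hf' (fun j => (hmR _).1) h1 (fun j => (hmR j).2) (fun x hx => ?_)
      rcases Fin.castSucc_lt_or_lt_succ c x with h | h
      · rwa [Fin.succAbove_of_castSucc_lt _ _ h] at hx
      · rw [Fin.succAbove_of_lt_succ _ _ h, Fin.val_succ] at hx
        omega

lemma mallowsProb_hasDecLast_succ_le {M k m : ℕ} {q : ℝ} (hq : 0 < q) (hq1 : q < 1) :
    mallowsProb M q {τ | HasDecLast τ k m} ≤ mallowsProb (M + 1) q {τ | HasDecLast τ k m} := by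
  have h2 : 0 < 1 - q ^ (M + 1) := sub_pos.2 (pow_lt_one₀ hq.le hq1 (by simp))
  rw [mallowsProb_succ hq hq1]
  have hs : ∑ c : Fin (M + 1), (1 - q) * q ^ (c : ℕ) / (1 - q ^ (M + 1)) = 1 := by
    rw [← Finset.sum_div, ← Finset.mul_sum, Fin.sum_univ_eq_sum_range (fun y => q ^ y),
      mul_neg_geom_sum, div_self h2.ne']
  conv_lhs => rw [← one_mul (mallowsProb M q _), ← hs, Finset.sum_mul]
  refine Finset.sum_le_sum fun c _ => mul_le_mul_of_nonneg_left ?_ ?_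
  · exact mallowsProb_mono hq fun τ hτ => HasDecLast.consPerm hτ c
  · have := sub_pos.2 hq1
    positivity

lemma mallowsProb_LDS_le {n L : ℕ} {q : ℝ} (hq : 0 < q) (hq1 : q < 1) (N : ℕ) :
    mallowsProb n q {π | L ≤ LDS π} ≤
      mallowsProb (n + N) q {π | HasDec π L n (n + N)} := by
  have h1 : mallowsProb n q {π | L ≤ LDS π} ≤
      mallowsProb (n + N) q {π | HasDecLast π L n} := by
    induction N with
    | zero => exact mallowsProb_mono hq fun π hπ => hasDecLast_of_le_LDS hπ
    | succ N ih => exact ih.trans (mallowsProb_hasDecLast_succ_le hq hq1)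
  refine h1.trans ?_
  rw [← mallowsProb_conj_rev q {π | HasDec π L n (n + N)}]
  exact mallowsProb_mono hq fun π hπ => hπ.conj_rev

lemma mallowsProb_hasDec_succ_le {M N k m R : ℕ} {q X Y : ℝ} {g : ℕ → ℝ} (hq : 0 < q)
    (hq1 : q < 1) (hN : 0 < N) (hNM : N ≤ M + 1)
    (hX : mallowsProb M q {π | HasDec π (k + 1) m (R - 1)} ≤ X)
    (hY : mallowsProb M q {π | HasDec π (k + 1) m R} ≤ Y)
    (hg : ∀ c, mallowsProb M q {π | HasDec π k m c} ≤ g c) :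
    mallowsProb (M + 1) q {π | HasDec π (k + 1) (m + 1) R} ≤
      1 / (1 - q ^ N) *
        ((1 - q ^ R) * X + q ^ R * Y + (1 - q) * ∑ c ∈ Finset.range R, q ^ c * g c) := by
  have hε := sub_pos.2 hq1
  have hX0 : 0 ≤ X := (mallowsProb_nonneg hq _).trans hX
  have hY0 : 0 ≤ Y := (mallowsProb_nonneg hq _).trans hY
  have hg0 : ∀ c, 0 ≤ g c := fun c => (mallowsProb_nonneg hq _).trans (hg c)
  have hN0 : 0 < 1 - q ^ N := sub_pos.2 (pow_lt_one₀ hq.le hq1 hN.ne')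
  have hNM' : 1 - q ^ N ≤ 1 - q ^ (M + 1) :=
    sub_le_sub_left (pow_le_pow_of_le_one hq.le hq1.le hNM) _
  set G : ℕ → ℝ := fun c => (1 - q) * q ^ c * if c < R then X + g c else Y with hG
  have hG0 : ∀ c, 0 ≤ G c := fun c => by
    have := hg0 c
    simp only [hG]
    split_ifs <;> positivity
  have h1 : mallowsProb (M + 1) q {π | HasDec π (k + 1) (m + 1) R} ≤
      ∑ c : Fin (M + 1), 1 / (1 - q ^ N) * G c := by
    rw [mallowsProb_succ hq hq1]
    refine Finset.sum_le_sum fun c _ => ?_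
    have hle : mallowsProb M q {τ | consPerm c τ ∈ {π | HasDec π (k + 1) (m + 1) R}} ≤
        if (c : ℕ) < R then X + g c else Y := by
      split_ifs with hc
      · refine le_trans ?_ (add_le_add hX (hg c))
        refine le_trans (mallowsProb_mono hq fun τ hτ => ?_) (mallowsProb_union_le hq _ _)
        rcases HasDec.of_consPerm hτ with h | h
        · exact h.2
        · omega
      · refine le_trans (mallowsProb_mono hq fun τ hτ => ?_) hY
        rcases HasDec.of_consPerm hτ with h | h
        · omega
        · exact h.2
    have hco : (1 - q) * q ^ (c : ℕ) / (1 - q ^ (M + 1)) ≤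
        1 / (1 - q ^ N) * ((1 - q) * q ^ (c : ℕ)) := by
      rw [div_eq_mul_one_div, mul_comm]
      exact mul_le_mul_of_nonneg_right (one_div_le_one_div_of_le hN0 hNM') (by positivity)
    calc _ ≤ 1 / (1 - q ^ N) * ((1 - q) * q ^ (c : ℕ)) * _ :=
          mul_le_mul hco hle (mallowsProb_nonneg hq _) (by positivity)
      _ = _ := by simp only [hG]; ring
  refine h1.trans ?_
  rw [← Finset.mul_sum, Fin.sum_univ_eq_sum_range G]
  refine mul_le_mul_of_nonneg_left ?_ (by positivity)
  have h2 : ∑ c ∈ Finset.range (M + 1), G c ≤ ∑ c ∈ Finset.range (R + (M + 1)), G c :=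
    Finset.sum_le_sum_of_subset_of_nonneg (Finset.range_mono (by omega)) fun c _ _ => hG0 c
  refine h2.trans ?_
  rw [Finset.sum_range_add]
  have h3 : ∑ c ∈ Finset.range R, G c =
      (1 - q ^ R) * X + (1 - q) * ∑ c ∈ Finset.range R, q ^ c * g c := by
    rw [← mul_neg_geom_sum, Finset.mul_sum, Finset.mul_sum, Finset.sum_mul,
      ← Finset.sum_add_distrib]
    refine Finset.sum_congr rfl fun c hc => ?_
    simp only [hG, Finset.mem_range.1 hc, if_true]
    ring
  have h4 : ∑ c ∈ Finset.range (M + 1), G (R + c) = q ^ R * (1 - q ^ (M + 1)) * Y := by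
    rw [← mul_neg_geom_sum, Finset.mul_sum, Finset.mul_sum, Finset.sum_mul]
    refine Finset.sum_congr rfl fun c hc => ?_
    simp only [hG, pow_add, not_lt.2 (Nat.le_add_right R c), if_false]
    ring
  rw [h3, h4]
  have : 0 ≤ q ^ R * q ^ (M + 1) * Y := by positivity
  linarith

/-- The stationary majorant for the probability that a decreasing subsequence of length `k`
appears below the level `R`. -/
noncomputable def decBound (q : ℝ) : ℕ → ℕ → ℝ
  | 0, _ => 1
  | k + 1, R => ∑ j ∈ Finset.range R,
      (1 - q) / (1 - q ^ (j + 1)) * ∑ i ∈ Finset.range (j + 1), q ^ i * decBound q k i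

lemma one_sub_pow_pos {q : ℝ} (hq : 0 < q) (hq1 : q < 1) (j : ℕ) : 0 < 1 - q ^ (j + 1) :=
  sub_pos.2 (pow_lt_one₀ hq.le hq1 (by simp))

lemma decBound_nonneg {q : ℝ} (hq : 0 < q) (hq1 : q < 1) (k R : ℕ) : 0 ≤ decBound q k R := by
  have hε := sub_pos.2 hq1
  induction k generalizing R with
  | zero => simp [decBound]
  | succ k ih =>
    rw [decBound]
    refine Finset.sum_nonneg fun j _ => mul_nonneg ?_ (Finset.sum_nonneg fun i _ => ?_)
    · exact div_nonneg hε.le (one_sub_pow_pos hq hq1 j).le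
    · have := ih i
      positivity

lemma decBound_succ_succ {q : ℝ} (k R : ℕ) :
    decBound q (k + 1) (R + 1) = decBound q (k + 1) R +
      (1 - q) / (1 - q ^ (R + 1)) * ∑ i ∈ Finset.range (R + 1), q ^ i * decBound q k i := by
  simp only [decBound, Finset.sum_range_succ _ R]

lemma mallowsProb_hasDec_zero {M k R : ℕ} {q : ℝ} :
    mallowsProb M q {π | HasDec π (k + 1) 0 R} = 0 := by
  have : {π : Equiv.Perm (Fin M) | HasDec π (k + 1) 0 R} = ∅ := by
    ext π
    simp [HasDec]
  rw [this]
  simp [mallowsProb]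

lemma one_le_inv_one_sub_pow {N : ℕ} {q : ℝ} (hq : 0 < q) (hq1 : q < 1) (hN : 0 < N) :
    1 ≤ 1 / (1 - q ^ N) := by
  have := pow_pos hq N
  rw [one_le_div (sub_pos.2 (pow_lt_one₀ hq.le hq1 hN.ne'))]
  linarith

lemma mallowsProb_hasDec_le {N m M k R : ℕ} {q : ℝ} (hq : 0 < q) (hq1 : q < 1) (hN : 0 < N)
    (hM : N + m ≤ M) :
    mallowsProb M q {π | HasDec π k m R} ≤ (1 / (1 - q ^ N)) ^ m * decBound q k R := by
  induction m generalizing M k R with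
  | zero =>
    cases k with
    | zero => simpa [decBound] using mallowsProb_le_one hq _
    | succ k =>
      rw [mallowsProb_hasDec_zero]
      simpa using decBound_nonneg hq hq1 _ _
  | succ m ih =>
    cases k with
    | zero =>
      simpa only [decBound, mul_one] using (mallowsProb_le_one hq _).trans
        (one_le_pow₀ (one_le_inv_one_sub_pow hq hq1 hN))
    | succ k =>
      obtain ⟨M, rfl⟩ : ∃ M', M = M' + 1 := ⟨M - 1, by omega⟩
      have h := mallowsProb_hasDec_succ_le (R := R) hq hq1 hN (by omega)
        (ih (M := M) (k := k + 1) (R := R - 1) (by omega)) (ih (k := k + 1) (R := R) (by omega))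
        (fun c => ih (k := k) (R := c) (by omega))
      refine h.trans (le_of_eq ?_)
      rw [pow_succ', mul_assoc]
      congr 1
      have hs : ∑ c ∈ Finset.range R, q ^ c * ((1 / (1 - q ^ N)) ^ m * decBound q k c) =
          (1 / (1 - q ^ N)) ^ m * ∑ c ∈ Finset.range R, q ^ c * decBound q k c := by
        rw [Finset.mul_sum]
        exact Finset.sum_congr rfl fun c _ => by ring
      rw [hs]
      cases R with
      | zero => simp
      | succ R =>
        rw [Nat.add_sub_cancel, decBound_succ_succ]
        have := (one_sub_pow_pos hq hq1 R).ne'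
        generalize (1 / (1 - q ^ N)) ^ m = ρ
        field_simp
        ring

lemma mallowsProb_hasDec_le_mul {N m M k R : ℕ} {q S : ℝ} (hq : 0 < q) (hq1 : q < 1)
    (hN : 0 < N) (hM : N + m ≤ M)
    (hS : ∀ R, (1 - q) * ∑ c ∈ Finset.range R, q ^ c * decBound q k c ≤ S) :
    mallowsProb M q {π | HasDec π (k + 1) m R} ≤ (1 / (1 - q ^ N)) ^ m * (m * S) := by
  induction m generalizing M R with
  | zero => simp [mallowsProb_hasDec_zero]
  | succ m ih =>
    obtain ⟨M, rfl⟩ : ∃ M', M = M' + 1 := ⟨M - 1, by omega⟩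
    have h := mallowsProb_hasDec_succ_le (R := R) hq hq1 hN (by omega)
      (ih (M := M) (R := R - 1) (by omega)) (ih (R := R) (by omega))
      (fun c => mallowsProb_hasDec_le (m := m) (k := k) (R := c) hq hq1 hN (by omega))
    refine h.trans ?_
    have hρ := one_le_inv_one_sub_pow hq hq1 hN
    rw [pow_succ', mul_assoc]
    refine mul_le_mul_of_nonneg_left ?_ (by linarith)
    have hs : ∑ c ∈ Finset.range R, q ^ c * ((1 / (1 - q ^ N)) ^ m * decBound q k c) =
        (1 / (1 - q ^ N)) ^ m * ∑ c ∈ Finset.range R, q ^ c * decBound q k c := by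
      rw [Finset.mul_sum]
      exact Finset.sum_congr rfl fun c _ => by ring
    rw [hs]
    have := mul_le_mul_of_nonneg_left (hS R) (a := (1 / (1 - q ^ N)) ^ m) (by positivity)
    push_cast
    linarith

lemma mallowsProb_LDS_le_mul {n k : ℕ} {q S : ℝ} (hq : 0 < q) (hq1 : q < 1)
    (hS : ∀ R, (1 - q) * ∑ c ∈ Finset.range R, q ^ c * decBound q k c ≤ S) :
    mallowsProb n q {π | k + 1 ≤ LDS π} ≤ n * S := by
  have h1 : Filter.Tendsto (fun N : ℕ => (1 / (1 - q ^ N)) ^ n * (n * S)) Filter.atTop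
      (nhds ((1 / (1 - 0)) ^ n * (n * S))) := by
    refine Filter.Tendsto.mul_const _ (Filter.Tendsto.pow (Filter.Tendsto.div tendsto_const_nhds
      (Filter.Tendsto.sub tendsto_const_nhds
        (tendsto_pow_atTop_nhds_zero_of_lt_one hq.le hq1)) (by norm_num)) n)
  have h2 := ge_of_tendsto (b := mallowsProb n q {π | k + 1 ≤ LDS π}) h1 <| by
    filter_upwards [Filter.eventually_gt_atTop 0] with N hN
    exact (mallowsProb_LDS_le hq hq1 N).trans
      (mallowsProb_hasDec_le_mul hq hq1 hN (by omega) hS)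
  simpa using h2

lemma decBound_eq_zero {q : ℝ} {k R : ℕ} (h : R < k) : decBound q k R = 0 := by
  induction k generalizing R with
  | zero => omega
  | succ k ih =>
    rw [decBound]
    refine Finset.sum_eq_zero fun j hj => ?_
    rw [Finset.mem_range] at hj
    rw [Finset.sum_eq_zero, mul_zero]
    intro i hi
    rw [Finset.mem_range] at hi
    rw [ih (by omega), mul_zero]

lemma sum_pow_mul_partial_sum_le {x : ℝ} (hx : 0 ≤ x) (hx1 : x < 1) {f : ℕ → ℝ}
    (hf : ∀ i, 0 ≤ f i) (R : ℕ) :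
    ∑ j ∈ Finset.range R, x ^ j * ∑ i ∈ Finset.range j, f i ≤
      x / (1 - x) * ∑ i ∈ Finset.range R, x ^ i * f i := by
  have h1 : 0 < 1 - x := by linarith
  have key : ∑ j ∈ Finset.range R, x ^ j * ∑ i ∈ Finset.range j, f i +
      x ^ R / (1 - x) * ∑ i ∈ Finset.range R, f i =
      x / (1 - x) * ∑ i ∈ Finset.range R, x ^ i * f i := by
    induction R with
    | zero => simp
    | succ R ih =>
      rw [Finset.sum_range_succ (fun i => x ^ i * f i), mul_add, ← ih, Finset.sum_range_succ,
        Finset.sum_range_succ f]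
      field_simp
      ring
  have : 0 ≤ x ^ R / (1 - x) * ∑ i ∈ Finset.range R, f i :=
    mul_nonneg (by positivity) (Finset.sum_nonneg fun i _ => hf i)
  linarith

lemma sum_pow_mul_partial_sum_succ_le {x : ℝ} (hx : 0 ≤ x) (hx1 : x < 1) {f : ℕ → ℝ}
    (hf : ∀ i, 0 ≤ f i) (R : ℕ) :
    ∑ j ∈ Finset.range R, x ^ j * ∑ i ∈ Finset.range (j + 1), f i ≤
      1 / (1 - x) * ∑ i ∈ Finset.range R, x ^ i * f i := by
  have h := sum_pow_mul_partial_sum_le hx hx1 hf R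
  have h1 : (1 : ℝ) - x ≠ 0 := by linarith
  have : 1 / (1 - x) = x / (1 - x) + 1 := by field_simp; ring
  simp only [Finset.sum_range_succ _ (_ : ℕ), mul_add, Finset.sum_add_distrib]
  rw [this, add_mul, one_mul]
  linarith

lemma sum_pow_mul_decBound_le {q : ℝ} (hq : 0 < q) (hq1 : q < 1) (k m R : ℕ) :
    ∑ c ∈ Finset.range R, (q ^ (m + 1)) ^ c * decBound q k c ≤
      (1 - q) ^ k * (∏ i ∈ Finset.range k, q ^ (m + i + 1) / (1 - q ^ (m + i + 1)) ^ 2) *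
        (∏ i ∈ Finset.range k, 1 / (1 - q ^ (i + 1))) * (1 / (1 - q ^ (m + k + 1))) := by
  have hε := sub_pos.2 hq1
  have hz := one_sub_pow_pos hq hq1
  induction k generalizing m R with
  | zero =>
    simp only [decBound, mul_one, pow_zero, Finset.prod_range_zero, one_mul, add_zero]
    rw [le_div_iff₀ (hz m), mul_comm, mul_neg_geom_sum]
    have : 0 < (q ^ (m + 1)) ^ R := by positivity
    linarith
  | succ k ih =>
    have hx0 : 0 ≤ q ^ (m + 1) := by positivity
    have hx1 : q ^ (m + 1) < 1 := by linarith [hz m]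
    have hb := decBound_nonneg hq hq1 k
    have hA : ∀ j, 0 ≤ ∑ i ∈ Finset.range (j + 1), q ^ i * decBound q k i := fun j =>
      Finset.sum_nonneg fun i _ => mul_nonneg (by positivity) (hb i)
    have hzm := hz m
    have hzk := hz k
    have h1 := sum_pow_mul_partial_sum_le hx0 hx1 (f := fun j =>
      (1 - q) / (1 - q ^ (j + 1)) * ∑ i ∈ Finset.range (j + 1), q ^ i * decBound q k i)
      (fun j => mul_nonneg (div_nonneg hε.le (hz j).le) (hA j)) R
    have h2 : ∑ j ∈ Finset.range R, (q ^ (m + 1)) ^ j * ((1 - q) / (1 - q ^ (j + 1)) *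
        ∑ i ∈ Finset.range (j + 1), q ^ i * decBound q k i) ≤
        (1 - q) / (1 - q ^ (k + 1)) * ∑ j ∈ Finset.range R, (q ^ (m + 1)) ^ j *
        ∑ i ∈ Finset.range (j + 1), q ^ i * decBound q k i := by
      rw [Finset.mul_sum]
      refine Finset.sum_le_sum fun j _ => ?_
      rcases lt_or_ge j k with hj | hj
      · rw [Finset.sum_eq_zero]
        · simp
        · intro i hi
          rw [Finset.mem_range] at hi
          rw [decBound_eq_zero (by omega), mul_zero]
      · rw [mul_left_comm]
        refine mul_le_mul_of_nonneg_right ?_ (mul_nonneg (by positivity) (hA j))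
        refine div_le_div_of_nonneg_left hε.le hzk ?_
        exact sub_le_sub_left (pow_le_pow_of_le_one hq.le hq1.le (by omega)) _
    have h3 := sum_pow_mul_partial_sum_succ_le hx0 hx1 (f := fun i => q ^ i * decBound q k i)
      (fun i => mul_nonneg (by positivity) (hb i)) R
    have h4 : ∑ i ∈ Finset.range R, (q ^ (m + 1)) ^ i * (q ^ i * decBound q k i) =
        ∑ c ∈ Finset.range R, (q ^ (m + 1 + 1)) ^ c * decBound q k c := by
      refine Finset.sum_congr rfl fun i _ => ?_
      rw [← mul_assoc, ← mul_pow, ← pow_succ]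
    rw [h4] at h3
    have h5 := ih (m + 1) R
    simp only [decBound]
    refine h1.trans ?_
    refine (mul_le_mul_of_nonneg_left (h2.trans (mul_le_mul_of_nonneg_left (h3.trans
      (mul_le_mul_of_nonneg_left h5 ?_)) ?_)) ?_).trans (le_of_eq ?_)
    · positivity
    · positivity
    · positivity
    · rw [Finset.prod_range_succ' (fun i => q ^ (m + i + 1) / (1 - q ^ (m + i + 1)) ^ 2),
        Finset.prod_range_succ (fun i => 1 / (1 - q ^ (i + 1)))]
      have e1 : ∀ i, m + 1 + i + 1 = m + (i + 1) + 1 := fun i => by omega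
      simp only [e1, add_zero, pow_succ (1 - q) k]
      field_simp

lemma prod_inv_one_sub_pow_le {q : ℝ} (hq : 0 < q) (hq1 : q < 1) {L : ℕ}
    (hL : 3 < (1 - q) * L) :
    ∏ i ∈ Finset.range L, 1 / (1 - q ^ (i + 1)) ≤ (2 * Real.exp 1) ^ L := by
  have hL0 : (0 : ℝ) < L := by
    by_contra! h
    nlinarith
  have h1 : ∀ i ∈ Finset.range L, 1 / (1 - q ^ (i + 1)) ≤ 2 * L * (1 / ((i : ℝ) + 1)) := by
    intro i hi
    have hi' : (i : ℝ) + 1 ≤ L := by exact_mod_cast Finset.mem_range.1 hi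
    have hb : 1 + ((i + 1 : ℕ) : ℝ) * (1 - q) ≤ (1 / q) ^ (i + 1) := by
      refine le_trans ?_ (one_add_mul_le_pow (a := 1 / q - 1) ?_ (i + 1)) |>.trans (by simp)
      · have : 1 - q ≤ 1 / q - 1 := by
          rw [le_sub_iff_add_le, le_div_iff₀ hq]
          nlinarith [sq_nonneg (1 - q)]
        have h0 : (0 : ℝ) ≤ ((i + 1 : ℕ) : ℝ) := by positivity
        nlinarith
      · have : 0 < 1 / q := by positivity
        linarith
    push_cast at hb
    rw [one_div_pow, le_div_iff₀ (by positivity)] at hb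
    have hqi : 0 < q ^ (i + 1) := by positivity
    rw [div_le_iff₀ (one_sub_pow_pos hq hq1 i), ← mul_div_assoc, mul_one, div_mul_eq_mul_div,
      le_div_iff₀ (by positivity), one_mul]
    set t := ((i : ℝ) + 1) with ht
    have ht0 : 0 < t := by positivity
    set p := q ^ (i + 1)
    have hp : p * L ≤ L - t / 2 := by
      have h3 : p * (L + 3 * t) ≤ L := by
        have : p * (t * 3) ≤ p * (t * ((1 - q) * L)) := by gcongr
        nlinarith
      have h4 : (L : ℝ) * L ≤ (L - t / 2) * (L + 3 * t) := by nlinarith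
      have h5 : p * L * (L + 3 * t) ≤ (L - t / 2) * (L + 3 * t) := by nlinarith
      exact le_of_mul_le_mul_right h5 (by positivity)
    linarith
  have h2 := Finset.prod_le_prod (fun i _ => (one_div_pos.2 (one_sub_pow_pos hq hq1 i)).le) h1
  refine h2.trans ?_
  have hfac : ∏ i ∈ Finset.range L, ((i : ℝ) + 1) = (L.factorial : ℝ) := by
    rw [← Finset.prod_range_add_one_eq_factorial]
    push_cast
    rfl
  rw [Finset.prod_mul_distrib, Finset.prod_const, Finset.card_range, Finset.prod_div_distrib,
    hfac, Finset.prod_const_one, mul_pow, mul_pow, mul_assoc, ← Real.exp_nat_mul, mul_one]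
  refine mul_le_mul_of_nonneg_left ?_ (by positivity)
  rw [mul_one_div]
  exact Real.pow_div_factorial_le_exp _ hL0.le _

lemma sum_decBound_le_of_large {q : ℝ} (hq : 0 < q) (hq1 : q < 1) {k : ℕ}
    (hL : 3 < (1 - q) * ((k + 1 : ℕ) : ℝ)) (R : ℕ) :
    (1 - q) * ∑ c ∈ Finset.range R, q ^ c * decBound q k c ≤
      (8 * Real.exp 1 ^ 3 * (1 - q)) ^ (k + 1) * q ^ ((k + 1) * k / 2) := by
  have hε := sub_pos.2 hq1
  have h1 := sum_pow_mul_decBound_le hq hq1 k 0 R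
  simp only [zero_add, pow_one] at h1
  have h2 := prod_inv_one_sub_pow_le hq hq1 hL
  set P := ∏ i ∈ Finset.range (k + 1), 1 / (1 - q ^ (i + 1)) with hP
  have hP0 : 0 ≤ P := Finset.prod_nonneg fun i _ => (one_div_pos.2 (one_sub_pow_pos hq hq1 i)).le
  have hqp : ∏ i ∈ Finset.range k, q ^ (i + 1) = q ^ ((k + 1) * k / 2) := by
    rw [Finset.prod_pow_eq_pow_sum]
    congr 1
    have := Finset.sum_range_id (k + 1)
    rw [Finset.sum_range_succ'] at this
    simpa using this
  have hone : 1 ≤ 1 / (1 - q ^ (k + 1)) := by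
    have := pow_pos hq (k + 1)
    rw [one_le_div (one_sub_pow_pos hq hq1 k)]
    linarith
  set Q := ∏ i ∈ Finset.range k, 1 / (1 - q ^ (i + 1)) with hQ
  have hQ0 : 0 ≤ Q := Finset.prod_nonneg fun i _ => (one_div_pos.2 (one_sub_pow_pos hq hq1 i)).le
  have hPQ : P = Q * (1 / (1 - q ^ (k + 1))) := by rw [hP, Finset.prod_range_succ]
  have hQP : Q ≤ P := by rw [hPQ]; exact le_mul_of_one_le_right hQ0 hone
  have hsplit : ∏ i ∈ Finset.range k, q ^ (i + 1) / (1 - q ^ (i + 1)) ^ 2 =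
      q ^ ((k + 1) * k / 2) * Q ^ 2 := by
    rw [← hqp, hQ, ← Finset.prod_pow, ← Finset.prod_mul_distrib]
    refine Finset.prod_congr rfl fun i _ => ?_
    rw [one_div_pow, mul_one_div]
  rw [hsplit, mul_assoc, ← hPQ] at h1
  calc _ ≤ (1 - q) * ((1 - q) ^ k * (q ^ ((k + 1) * k / 2) * Q ^ 2) * P) := by gcongr
    _ ≤ (1 - q) * ((1 - q) ^ k * (q ^ ((k + 1) * k / 2) *
          ((2 * Real.exp 1) ^ (k + 1)) ^ 2) * (2 * Real.exp 1) ^ (k + 1)) := by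
        gcongr
        exact hQP.trans h2
    _ = ((2 * Real.exp 1) ^ 3 * (1 - q)) ^ (k + 1) * q ^ ((k + 1) * k / 2) := by
        rw [mul_pow _ (1 - q)]
        generalize 2 * Real.exp 1 = e
        ring
    _ = _ := by rw [mul_pow 2]; norm_num

lemma growth_rate_le {a s w y : ℝ} (ha : 0 < a) (hs : 0 ≤ s) (hs1 : s ≤ 1) (hw : 0 < w)
    (hy : 0 ≤ y) (hw2 : w ^ 2 = 1 - s ^ 2 * a ^ 2) (hy2 : y ^ 2 = 1 - a ^ 2) :
    (1 - s ^ 2) * a / w ≤ 4 * ((w - y) + (a - s * a)) := by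
  have hs2 : 0 ≤ 1 - s ^ 2 := by nlinarith
  have hyw : y ≤ w := by
    refine (sq_le_sq₀ hy hw.le).1 ?_
    nlinarith [mul_nonneg hs2 (sq_nonneg a)]
  have haw : 1 ≤ 2 * a + 2 * w := by nlinarith
  have h1 : (1 - s ^ 2) * a ^ 2 ≤ (w - y) * (2 * w) := by nlinarith
  have h2 : (1 - s ^ 2) * a ≤ 2 * (a - s * a) := by
    nlinarith [mul_nonneg (mul_nonneg (sub_nonneg.2 hs1) ha.le) (sub_nonneg.2 hs1)]
  rw [div_le_iff₀ hw]
  have h3 : (1 - s ^ 2) * a * 1 ≤ (1 - s ^ 2) * a * (2 * a + 2 * w) :=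
    mul_le_mul_of_nonneg_left haw (by positivity)
  nlinarith [mul_le_mul_of_nonneg_right h2 hw.le]

lemma sum_decBound_le {q : ℝ} (hq : 0 < q) (hq1 : q < 1) {μ : ℝ} (hμ : 0 < μ) (k R : ℕ) :
    (μ ^ 2 * (1 - q)) ^ k * ((1 - q) * ∑ c ∈ Finset.range R, q ^ c * decBound q k c) ≤
      Real.exp (16 * μ) / μ := by
  have hε := sub_pos.2 hq1
  set s := √q with hs
  have hs0 : 0 < s := Real.sqrt_pos.2 hq
  have hs2 : s ^ 2 = q := Real.sq_sqrt hq.le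
  have hs1 : s ≤ 1 := Real.sqrt_le_one.2 hq1.le
  have hsR : ∀ r, 0 < s ^ r := fun r => pow_pos hs0 r
  set w : ℕ → ℝ := fun r => √(1 - q ^ r) with hw
  have hw2 : ∀ r, w r ^ 2 = 1 - q ^ r := fun r =>
    Real.sq_sqrt (sub_nonneg.2 (pow_le_one₀ hq.le hq1.le))
  have hw0 : ∀ r, 0 ≤ w r := fun r => Real.sqrt_nonneg _
  have hwpos : ∀ r, 0 < w (r + 1) := fun r => Real.sqrt_pos.2 (one_sub_pow_pos hq hq1 r)
  have hwmono : ∀ r, w r ≤ w (r + 1) := fun r => Real.sqrt_le_sqrt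
    (sub_le_sub_left (pow_le_pow_of_le_one hq.le hq1.le (Nat.le_succ r)) _)
  have hw1 : ∀ r, w r ≤ 1 := fun r => Real.sqrt_le_one.2 (by have := pow_pos hq r; linarith)
  set δ : ℕ → ℝ := fun r => μ * ((1 - q) * s ^ r / w (r + 1)) with hδ
  have hδ0 : ∀ r, 0 ≤ δ r := fun r => by
    have := hwpos r
    have := hsR r
    simp only [hδ]; positivity
  set E : ℕ → ℝ := fun r => ∏ i ∈ Finset.range r, (1 + δ i) ^ 2 with hE
  have hE1 : ∀ r, 1 ≤ E r := fun r => by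
    simp only [hE]
    refine Finset.prod_induction _ (fun x => 1 ≤ x) (fun _ _ => one_le_mul_of_one_le_of_one_le)
      le_rfl fun i _ => one_le_pow₀ (by linarith [hδ0 i])
  have hEs : ∀ r, E (r + 1) = (1 + δ r) ^ 2 * E r := fun r => by
    simp only [hE, Finset.prod_range_succ]; ring
  have hEle : ∀ r, E r ≤ Real.exp (8 * μ * (w r + (1 - s ^ r))) := by
    intro r
    induction r with
    | zero => simp [hE, hw]
    | succ r ih =>
      have hg := growth_rate_le (hsR r) hs0.le hs1 (hwpos r) (hw0 r)
        (by rw [hw2, ← pow_mul, mul_comm r 2, pow_mul s 2 r, hs2]; ring)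
        (by rw [hw2, ← pow_mul, mul_comm r 2, pow_mul s 2 r, hs2])
      rw [hs2] at hg
      have h1 : 1 + δ r ≤ Real.exp (δ r) := by linarith [Real.add_one_le_exp (δ r)]
      have h2 : (1 + δ r) ^ 2 ≤ Real.exp (2 * δ r) := by
        rw [two_mul, Real.exp_add, ← sq]
        exact pow_le_pow_left₀ (by linarith [hδ0 r]) h1 2
      rw [hEs]
      refine (mul_le_mul h2 ih (by linarith [hE1 r]) (Real.exp_pos _).le).trans ?_
      rw [← Real.exp_add, Real.exp_le_exp]
      have h3 : δ r ≤ μ * (4 * ((w (r + 1) - w r) + (s ^ r - s * s ^ r))) :=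
        mul_le_mul_of_nonneg_left hg hμ.le
      rw [pow_succ s r]
      linarith
  set B : ℕ → ℕ → ℝ := fun k R => (1 - q) * ∑ c ∈ Finset.range R, q ^ c * decBound q k c with hB
  set l := μ ^ 2 * (1 - q) with hl
  have hl0 : 0 < l := by positivity
  have hBu : ∀ k, (∀ R, l ^ k * decBound q k R ≤ E R / s ^ R) →
      ∀ R, l ^ k * B k R ≤ w R * E R / μ ∧
        l ^ k * B k (R + 1) ≤ w (R + 1) * ((1 + δ R) * E R) / μ := by
    intro k hk
    have hstep : ∀ R, l ^ k * B k R ≤ w R * E R / μ →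
        l ^ k * B k (R + 1) ≤ w (R + 1) * ((1 + δ R) * E R) / μ := by
      intro R ih
      have e1 : l ^ k * B k (R + 1) =
          l ^ k * B k R + (1 - q) * q ^ R * (l ^ k * decBound q k R) := by
        simp only [hB, Finset.sum_range_succ]; ring
      have h1 : (1 - q) * q ^ R * (l ^ k * decBound q k R) ≤
          (1 - q) * q ^ R * (E R / s ^ R) :=
        mul_le_mul_of_nonneg_left (hk R) (by positivity)
      have h2 : (1 - q) * q ^ R * (E R / s ^ R) = w (R + 1) * (δ R * E R) / μ := by
        have := (hwpos R).ne'
        have := (hsR R).ne'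
        have e : q ^ R = s ^ R * s ^ R := by rw [← mul_pow, ← sq, hs2]
        simp only [hδ]
        rw [e]
        field_simp
      have h3 : w R * E R / μ ≤ w (R + 1) * E R / μ := by
        have := hE1 R
        have := hwmono R
        gcongr
      have h4 : w (R + 1) * ((1 + δ R) * E R) / μ =
          w (R + 1) * E R / μ + w (R + 1) * (δ R * E R) / μ := by ring
      linarith
    have hall : ∀ R, l ^ k * B k R ≤ w R * E R / μ := by
      intro R
      induction R with
      | zero => simp [hB, hw]
      | succ R ih =>
        refine (hstep R ih).trans ?_
        have := hE1 R
        have h5 := hδ0 R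
        rw [hEs]
        have := hw0 (R + 1)
        gcongr
        nlinarith
    exact fun R => ⟨hall R, hstep R (hall R)⟩
  have hu : ∀ k R, l ^ k * decBound q k R ≤ E R / s ^ R := by
    intro k
    induction k with
    | zero =>
      intro R
      rw [decBound, pow_zero, one_mul, le_div_iff₀ (hsR R), one_mul]
      exact (pow_le_one₀ hs0.le hs1).trans (hE1 R)
    | succ k ihk =>
      intro R
      induction R with
      | zero => simp [decBound, hE]
      | succ R ih =>
        have e1 : l ^ (k + 1) * decBound q (k + 1) (R + 1) =
            l ^ (k + 1) * decBound q (k + 1) R + l / w (R + 1) ^ 2 * (l ^ k * B k (R + 1)) := by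
          rw [decBound_succ_succ, hw2]
          simp only [hB]
          ring
        have hwp := hwpos R
        have h1 : l / w (R + 1) ^ 2 * (l ^ k * B k (R + 1)) ≤
            l / w (R + 1) ^ 2 * (w (R + 1) * ((1 + δ R) * E R) / μ) :=
          mul_le_mul_of_nonneg_left (hBu k ihk R).2 (by positivity)
        have h2 : l / w (R + 1) ^ 2 * (w (R + 1) * ((1 + δ R) * E R) / μ) =
            δ R * ((1 + δ R) * E R) / s ^ R := by
          have := (hsR R).ne'
          generalize hD : (1 + δ R) * E R = D
          simp only [hδ, hl]
          field_simp
        have h3 : E R / s ^ R + δ R * ((1 + δ R) * E R) / s ^ R ≤ E (R + 1) / s ^ R := by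
          rw [← add_div]
          have := hsR R
          gcongr
          rw [hEs]
          nlinarith [hδ0 R, hE1 R, mul_nonneg (hδ0 R) (zero_le_one.trans (hE1 R))]
        have h4 : E (R + 1) / s ^ R ≤ E (R + 1) / s ^ (R + 1) :=
          div_le_div_of_nonneg_left (by linarith [hE1 (R + 1)]) (hsR _)
            (pow_le_pow_of_le_one hs0.le hs1 (Nat.le_succ R))
        linarith
  refine ((hBu k (hu k)) R).1.trans ?_
  gcongr
  calc w R * E R ≤ 1 * E R := mul_le_mul_of_nonneg_right (hw1 R) (by linarith [hE1 R])
    _ ≤ Real.exp (8 * μ * (w R + (1 - s ^ R))) := by rw [one_mul]; exact hEle R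
    _ ≤ _ := by
      rw [Real.exp_le_exp]
      have : w R + (1 - s ^ R) ≤ 2 := by linarith [hw1 R, hsR R]
      nlinarith

lemma sum_decBound_le_of_small {q : ℝ} (hq : 0 < q) (hq1 : q < 1) {k : ℕ}
    (hL : (1 - q) * ((k + 1 : ℕ) : ℝ) ≤ 3) (R : ℕ) :
    (1 - q) * ∑ c ∈ Finset.range R, q ^ c * decBound q k c ≤
      (3 * Real.exp 16 / ((1 - q) * ((k + 1 : ℕ) : ℝ) ^ 2)) ^ (k + 1) := by
  have hε := sub_pos.2 hq1
  have hμ : (0 : ℝ) < ((k + 1 : ℕ) : ℝ) := by positivity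
  have h := sum_decBound_le hq hq1 hμ k R
  have he : Real.exp (16 * ((k + 1 : ℕ) : ℝ)) = Real.exp 16 ^ (k + 1) := by
    rw [mul_comm, Real.exp_nat_mul]
  rw [he] at h
  generalize ((k + 1 : ℕ) : ℝ) = μ at *
  set b := (1 - q) * ∑ c ∈ Finset.range R, q ^ c * decBound q k c
  rw [div_pow, le_div_iff₀ (by positivity), mul_pow 3]
  calc b * ((1 - q) * μ ^ 2) ^ (k + 1) = ((1 - q) * μ ^ 2) * ((μ ^ 2 * (1 - q)) ^ k * b) := by
        ring
    _ ≤ ((1 - q) * μ ^ 2) * (Real.exp 16 ^ (k + 1) / μ) := by gcongr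
    _ = ((1 - q) * μ) * Real.exp 16 ^ (k + 1) := by field_simp
    _ ≤ 3 ^ (k + 1) * Real.exp 16 ^ (k + 1) := by
        gcongr
        exact hL.trans (le_self_pow₀ (by norm_num) (by simp))

/-- There is an absolute constant `C>0` so that for `n≥2`, `0<q<1−2/n`
and integer `L≥2`, if `π ~ μ_{n,q}` then `P(LDS(π) ≥ L)` is at most
`n^8 (C/((1−q)L²))^L` when `L ≤ 3/(1−q)`, and at most `n^8 (C(1−q))^L q^{L(L−1)/2}`
when `L > 3/(1−q)`. -/
theorem mallows_LDS_upper_tail :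
    ∃ C : ℝ, 0 < C ∧
      ∀ (n : ℕ) (q : ℝ) (L : ℕ), 2 ≤ n → 0 < q → q < 1 - 2 / (n : ℝ) → 2 ≤ L →
        ((L : ℝ) ≤ 3 / (1 - q) →
            mallowsProb n q {π | L ≤ LDS π} ≤
              (n : ℝ) ^ 8 * (C / ((1 - q) * (L : ℝ) ^ 2)) ^ L) ∧
        (3 / (1 - q) < (L : ℝ) →
            mallowsProb n q {π | L ≤ LDS π} ≤
              (n : ℝ) ^ 8 * (C * (1 - q)) ^ L * q ^ (L * (L - 1) / 2)) := by
  refine ⟨3 * Real.exp 16, by positivity, fun n q L hn hq hqn hL => ?_⟩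
  have hn1 : (1 : ℝ) ≤ n := by exact_mod_cast (by omega : 1 ≤ n)
  have hq1 : q < 1 := by
    have : 0 < 2 / (n : ℝ) := by positivity
    linarith
  have hε := sub_pos.2 hq1
  have hn8 : (n : ℝ) ≤ (n : ℝ) ^ 8 := le_self_pow₀ hn1 (by norm_num)
  obtain ⟨k, rfl⟩ : ∃ k, L = k + 1 := ⟨L - 1, by omega⟩
  refine ⟨fun h => ?_, fun h => ?_⟩
  · rw [le_div_iff₀ hε, mul_comm] at h
    refine (mallowsProb_LDS_le_mul hq hq1 (sum_decBound_le_of_small hq hq1 h)).trans ?_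
    gcongr
  · rw [div_lt_iff₀ hε, mul_comm] at h
    refine (mallowsProb_LDS_le_mul hq hq1 (sum_decBound_le_of_large hq hq1 h)).trans ?_
    rw [Nat.add_sub_cancel, mul_assoc ((n : ℝ) ^ 8)]
    have h2 : 8 * Real.exp 1 ^ 3 ≤ 3 * Real.exp 16 := by
      have h3 : Real.exp 16 = Real.exp 1 ^ 3 * Real.exp 13 := by
        rw [← Real.exp_nat_mul, ← Real.exp_add]; norm_num
      have h4 : (14 : ℝ) ≤ Real.exp 13 := by linarith [Real.add_one_le_exp (13 : ℝ)]
      rw [h3]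
      nlinarith [pow_pos (Real.exp_pos 1) 3]
    gcongr
end

section
/- There exists an absolute constant C > 0 such that for every integer n≥2, every real q with 0 < q < 1/2, and every integer L ≥ 2, if π is distributed according to the (n,q)-Mallows measure, then P(LDS(π) ≥ L) ≤ n·C^L·q^{L(L−1)/2}. -/
open Finset

/-- Prepend the value `p` to a permutation `σ`, shifting up the values of `σ` that are at least
`p`. -/
def insertFront {n : ℕ} (p : Fin (n + 1)) (σ : Equiv.Perm (Fin n)) : Equiv.Perm (Fin (n + 1)) :=
  (finSuccEquiv' 0).trans ((Equiv.optionCongr σ).trans (finSuccEquiv' p).symm)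

@[simp]
lemma insertFront_zero {n : ℕ} (p : Fin (n + 1)) (σ : Equiv.Perm (Fin n)) :
    insertFront p σ 0 = p := by
  simp [insertFront]

@[simp]
lemma insertFront_succ {n : ℕ} (p : Fin (n + 1)) (σ : Equiv.Perm (Fin n)) (i : Fin n) :
    insertFront p σ i.succ = p.succAbove (σ i) := by
  simp only [insertFront, Equiv.trans_apply]
  rw [← Fin.succAbove_zero, finSuccEquiv'_succAbove]
  simp

lemma insertFront_bijective (n : ℕ) :
    Function.Bijective
      (fun x : Fin (n + 1) × Equiv.Perm (Fin n) => insertFront x.1 x.2) := by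
  rw [Fintype.bijective_iff_injective_and_card]
  refine ⟨?_, by simp [Fintype.card_perm, Nat.factorial_succ]⟩
  rintro ⟨p, σ⟩ ⟨p', σ'⟩ h
  have hp : p = p' := by simpa using congrArg (fun π => π 0) h
  subst hp
  refine Prod.ext rfl (Equiv.ext fun i => ?_)
  simpa using congrArg (fun π => π i.succ) h

lemma mallowsInv_insertFront {n : ℕ} (p : Fin (n + 1)) (σ : Equiv.Perm (Fin n)) :
    mallowsInv (insertFront p σ) = p + mallowsInv σ := by
  have hp : ∑ j : Fin n, (if p.succAbove (σ j) < p then 1 else 0) = (p : ℕ) := by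
    rw [Equiv.sum_comp σ (fun j => if p.succAbove j < p then 1 else 0)]
    simp only [Fin.succAbove_lt_iff_castSucc_lt]
    simp only [Fin.lt_def, Fin.val_castSucc]
    rw [Fin.sum_univ_eq_sum_range (fun j => if j < (p : ℕ) then 1 else 0) n, ← Finset.card_filter]
    have : (Finset.range n).filter (fun j => j < (p : ℕ)) = Finset.range p := by
      ext j
      have := p.isLt
      simp only [Finset.mem_filter, Finset.mem_range]
      omega
    rw [this, Finset.card_range]
  simp only [mallowsInv, Finset.card_filter, Fintype.sum_prod_type, Fin.sum_univ_succ,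
    insertFront_zero, insertFront_succ, false_and, if_false, Fin.succ_pos, true_and,
    Fin.not_lt_zero, Fin.succ_lt_succ_iff, zero_add, hp,
    (Fin.strictMono_succAbove p).lt_iff_lt]

/-- The permutation `σ` has a decreasing subsequence of length `k + 1` starting with the
value `v`. -/
def HasDecreasingFrom {n : ℕ} (k : ℕ) (σ : Equiv.Perm (Fin n)) (v : ℕ) : Prop :=
  ∃ f : Fin (k + 1) → Fin n, StrictMono f ∧ StrictAnti (fun j => σ (f j)) ∧ (σ (f 0) : ℕ) = v

lemma exists_subsequence_of_insertFront {n m : ℕ} {p : Fin (n + 1)} {σ : Equiv.Perm (Fin n)}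
    {f : Fin m → Fin (n + 1)} (hf : StrictMono f)
    (hanti : StrictAnti fun j => insertFront p σ (f j)) (h0 : ∀ j, f j ≠ 0) :
    ∃ g : Fin m → Fin n, (∀ j, f j = (g j).succ) ∧ StrictMono g ∧ StrictAnti fun j => σ (g j) := by
  choose g hg using fun j => Fin.exists_succ_eq.2 (h0 j)
  refine ⟨g, fun j => (hg j).symm, fun a b hab => ?_, fun a b hab => ?_⟩
  · have := hf hab
    rwa [← hg, ← hg, Fin.succ_lt_succ_iff] at this
  · have := hanti hab
    simpa only [← hg, insertFront_succ, (Fin.strictMono_succAbove p).lt_iff_lt] using this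

lemma HasDecreasingFrom.of_insertFront {n k w : ℕ} {p : Fin (n + 1)} {σ : Equiv.Perm (Fin n)}
    (h : HasDecreasingFrom (k + 1) (insertFront p σ) w) :
    ((p : ℕ) = w ∧ ∃ v < w, HasDecreasingFrom k σ v) ∨
      (w < p ∧ HasDecreasingFrom (k + 1) σ w) ∨
      (p < w ∧ HasDecreasingFrom (k + 1) σ (w - 1)) := by
  obtain ⟨f, hf, hanti, hw⟩ := h
  by_cases h0 : f 0 = 0
  · left
    rw [h0, insertFront_zero] at hw
    refine ⟨hw, ?_⟩
    obtain ⟨g, hg, hg1, hg2⟩ := exists_subsequence_of_insertFront (p := p) (σ := σ)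
      (f := fun j => f j.succ) (fun a b hab => hf (Fin.succ_lt_succ_iff.2 hab))
      (fun a b hab => hanti (Fin.succ_lt_succ_iff.2 hab))
      (fun j hj => (hf (Fin.succ_pos j)).ne (h0.trans hj.symm))
    refine ⟨σ (g 0), ?_, g, hg1, hg2, rfl⟩
    have := hanti (Fin.succ_pos (0 : Fin (k + 1)))
    simp only [hg, h0, insertFront_zero, insertFront_succ,
      Fin.succAbove_lt_iff_castSucc_lt] at this
    rw [Fin.lt_def, Fin.val_castSucc] at this
    omega
  · right
    obtain ⟨g, hg, hg1, hg2⟩ := exists_subsequence_of_insertFront hf hanti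
      (fun j hj => h0 (Fin.le_zero_iff.1 (hj ▸ hf.monotone (Fin.zero_le j))))
    rw [hg, insertFront_succ] at hw
    rcases lt_or_ge (σ (g 0)).castSucc p with hlt | hge
    · left
      rw [Fin.succAbove_of_castSucc_lt _ _ hlt, Fin.val_castSucc] at hw
      rw [Fin.lt_def, Fin.val_castSucc] at hlt
      exact ⟨by omega, g, hg1, hg2, hw⟩
    · right
      rw [Fin.succAbove_of_le_castSucc _ _ hge, Fin.val_succ] at hw
      rw [Fin.le_def, Fin.val_castSucc] at hge
      exact ⟨by omega, g, hg1, hg2, by omega⟩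

open Classical in
/-- The total weight `q ^ inv σ` of the permutations having a decreasing subsequence of length
`k + 1` starting with the value `v`. -/
noncomputable def decreasingWeight (n : ℕ) (q : ℝ) (k v : ℕ) : ℝ :=
  ∑ σ : Equiv.Perm (Fin n), if HasDecreasingFrom k σ v then q ^ mallowsInv σ else 0

/-- The normalizing constant of the Mallows measure. -/
noncomputable def mallowsZ (n : ℕ) (q : ℝ) : ℝ :=
  ∑ σ : Equiv.Perm (Fin n), q ^ mallowsInv σ

lemma sum_perm_succ_s11 {n : ℕ} (F : Equiv.Perm (Fin (n + 1)) → ℝ) :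
    ∑ π, F π = ∑ p : Fin (n + 1), ∑ σ : Equiv.Perm (Fin n), F (insertFront p σ) := by
  rw [← Fintype.sum_prod_type', ← (insertFront_bijective n).sum_comp]

lemma mallowsZ_succ (n : ℕ) (q : ℝ) :
    mallowsZ (n + 1) q = (∑ p : Fin (n + 1), q ^ (p : ℕ)) * mallowsZ n q := by
  simp only [mallowsZ, sum_perm_succ_s11, mallowsInv_insertFront, pow_add, Finset.sum_mul_sum]

lemma mallowsZ_pos (n : ℕ) {q : ℝ} (hq : 0 < q) : 0 < mallowsZ n q :=
  Finset.sum_pos (fun _ _ => pow_pos hq _) Finset.univ_nonempty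

lemma decreasingWeight_nonneg (n : ℕ) {q : ℝ} (hq : 0 < q) (k v : ℕ) :
    0 ≤ decreasingWeight n q k v :=
  Finset.sum_nonneg fun _ _ => by split_ifs <;> positivity

lemma decreasingWeight_le (n : ℕ) {q : ℝ} (hq : 0 < q) (k v : ℕ) :
    decreasingWeight n q k v ≤ mallowsZ n q :=
  Finset.sum_le_sum fun _ _ => by split_ifs <;> first | exact le_rfl | positivity

lemma decreasingWeight_succ_le (n : ℕ) {q : ℝ} (hq : 0 < q) (k w : ℕ) :
    decreasingWeight (n + 1) q (k + 1) w ≤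
      ∑ p : Fin (n + 1), q ^ (p : ℕ) *
        ((if (p : ℕ) = w then ∑ v ∈ Finset.range w, decreasingWeight n q k v else 0) +
          (if w < p then decreasingWeight n q (k + 1) w else 0) +
          (if p < w then decreasingWeight n q (k + 1) (w - 1) else 0)) := by
  classical
  rw [decreasingWeight, sum_perm_succ_s11]
  refine Finset.sum_le_sum fun p _ => ?_
  have hnn : ∀ σ : Equiv.Perm (Fin n), 0 ≤ q ^ mallowsInv σ := fun σ => by positivity
  have hterm : ∀ (j : ℕ) (σ : Equiv.Perm (Fin n)) (v : ℕ),
      0 ≤ if HasDecreasingFrom j σ v then q ^ mallowsInv σ else 0 :=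
    fun j σ v => by split_ifs <;> positivity
  have hfactor : ∀ σ : Equiv.Perm (Fin n),
      (if HasDecreasingFrom (k + 1) (insertFront p σ) w
        then q ^ mallowsInv (insertFront p σ) else 0) =
      q ^ (p : ℕ) * (if HasDecreasingFrom (k + 1) (insertFront p σ) w
        then q ^ mallowsInv σ else 0) := fun σ => by
    rw [mallowsInv_insertFront, pow_add, mul_ite, mul_zero]
  simp_rw [hfactor]
  rw [← Finset.mul_sum]
  refine mul_le_mul_of_nonneg_left ?_ (by positivity)
  rcases lt_trichotomy (p : ℕ) w with h | h | h
  · rw [if_neg h.ne, if_neg h.not_gt, if_pos h, zero_add, zero_add]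
    refine Finset.sum_le_sum fun σ _ => ?_
    split_ifs with h1 h2 <;> first | exact le_rfl | exact hnn σ | skip
    rcases h1.of_insertFront with h3 | h3 | h3
    · omega
    · omega
    · exact absurd h3.2 h2
  · rw [if_pos h, if_neg (by omega), if_neg (by omega), add_zero, add_zero]
    simp only [decreasingWeight]
    rw [Finset.sum_comm]
    refine Finset.sum_le_sum fun σ _ => ?_
    split_ifs with h1
    · rcases h1.of_insertFront with ⟨-, v, hv, h3⟩ | h3 | h3
      · refine le_trans (by rw [if_pos h3]) (Finset.single_le_sum
          (f := fun v => if HasDecreasingFrom k σ v then q ^ mallowsInv σ else 0)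
          (fun v _ => hterm k σ v) (Finset.mem_range.2 hv))
      · omega
      · omega
    · exact Finset.sum_nonneg fun v _ => hterm k σ v
  · rw [if_neg h.ne', if_pos h, if_neg h.not_gt, zero_add, add_zero]
    refine Finset.sum_le_sum fun σ _ => ?_
    split_ifs with h1 h2 <;> first | exact le_rfl | exact hnn σ | skip
    rcases h1.of_insertFront with h3 | h3 | h3
    · omega
    · exact absurd h3.2 h2
    · omega

lemma sum_pow_eq_le (n : ℕ) {q : ℝ} (hq : 0 < q) (w : ℕ) :
    ∑ p : Fin (n + 1), (if (p : ℕ) = w then q ^ (p : ℕ) else 0) ≤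
      q ^ w * ∑ p : Fin (n + 1), q ^ (p : ℕ) := by
  have h1 : (1 : ℝ) ≤ ∑ p : Fin (n + 1), q ^ (p : ℕ) := by
    rw [Fin.sum_univ_succ]
    simp only [Fin.val_zero, pow_zero, le_add_iff_nonneg_right]
    positivity
  refine le_trans ?_ (le_mul_of_one_le_right (by positivity) h1)
  rw [Fin.sum_univ_eq_sum_range (fun j => if j = w then q ^ j else 0), Finset.sum_ite_eq']
  split_ifs
  · exact le_rfl
  · positivity

lemma sum_pow_gt_le (n : ℕ) {q : ℝ} (hq : 0 < q) (w : ℕ) :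
    ∑ p : Fin (n + 1), (if w < (p : ℕ) then q ^ (p : ℕ) else 0) ≤
      q ^ (w + 1) * ∑ p : Fin (n + 1), q ^ (p : ℕ) := by
  rw [Fin.sum_univ_eq_sum_range (fun j => if w < j then q ^ j else 0),
    Fin.sum_univ_eq_sum_range (fun j => q ^ j), ← Finset.sum_filter, Finset.mul_sum]
  simp_rw [← pow_add]
  rw [← Finset.sum_image (s := Finset.range (n + 1)) (g := fun i => w + 1 + i)
    (f := fun j => q ^ j) (fun a _ b _ h => Nat.add_left_cancel h)]
  refine Finset.sum_le_sum_of_subset_of_nonneg (fun j hj => ?_) (fun _ _ _ => by positivity)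
  simp only [Finset.mem_filter, Finset.mem_range, Finset.mem_image] at hj ⊢
  exact ⟨j - (w + 1), by omega, by omega⟩

lemma decreasingWeight_succ_le_mul (n : ℕ) {q : ℝ} (hq : 0 < q) (k w : ℕ) :
    decreasingWeight (n + 1) q (k + 1) w ≤
      (∑ p : Fin (n + 1), q ^ (p : ℕ)) *
        (q ^ w * ∑ v ∈ Finset.range w, decreasingWeight n q k v +
          q ^ (w + 1) * decreasingWeight n q (k + 1) w +
          if 0 < w then decreasingWeight n q (k + 1) (w - 1) else 0) := by
  refine (decreasingWeight_succ_le n hq k w).trans ?_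
  set S := ∑ v ∈ Finset.range w, decreasingWeight n q k v with hS
  have hS0 : 0 ≤ S := Finset.sum_nonneg fun v _ => decreasingWeight_nonneg n hq k v
  have h1 := mul_le_mul_of_nonneg_right (sum_pow_eq_le n hq w) hS0
  have h2 := mul_le_mul_of_nonneg_right (sum_pow_gt_le n hq w)
    (decreasingWeight_nonneg n hq (k + 1) w)
  have h3 : ∑ p : Fin (n + 1), (if (p : ℕ) < w then
        q ^ (p : ℕ) * decreasingWeight n q (k + 1) (w - 1) else 0) ≤
      (∑ p : Fin (n + 1), q ^ (p : ℕ)) *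
        if 0 < w then decreasingWeight n q (k + 1) (w - 1) else 0 := by
    rw [Finset.sum_mul]
    refine Finset.sum_le_sum fun p _ => ?_
    have := decreasingWeight_nonneg n hq (k + 1) (w - 1)
    split_ifs
    · exact le_rfl
    · omega
    · positivity
    · simp
  rw [Finset.sum_mul] at h1 h2
  simp only [mul_add, mul_ite, mul_zero, ite_mul, zero_mul, Finset.sum_add_distrib] at h1 h2 h3 ⊢
  linarith

/-- The amplitude of the bound on `decreasingWeight`. -/
noncomputable def decreasingAmplitude (q : ℝ) (k : ℕ) : ℝ := 24 ^ k * q ^ ((k + 1) * k / 2)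

lemma decreasingAmplitude_succ (q : ℝ) (k : ℕ) :
    decreasingAmplitude q (k + 1) = 24 * q ^ (k + 1) * decreasingAmplitude q k := by
  have : (k + 1 + 1) * (k + 1) / 2 = (k + 1) + (k + 1) * k / 2 := by
    rw [show (k + 1 + 1) * (k + 1) = (k + 1) * k + (k + 1) * 2 by ring,
      Nat.add_mul_div_right _ _ two_pos, add_comm]
  rw [decreasingAmplitude, decreasingAmplitude, this, pow_add q, pow_succ 24]
  ring

/-- A supersolution of the recursion satisfied by `decreasingWeight n q k v / mallowsZ n q`. -/
noncomputable def decreasingBound (q : ℝ) : ℕ → ℕ → ℝ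
  | 0, _ => 1
  | k + 1, v => decreasingAmplitude q (k + 1) * (1 - (3 / 4) ^ (v - k))

lemma decreasingBound_succ (q : ℝ) (k v : ℕ) :
    decreasingBound q (k + 1) v = decreasingAmplitude q (k + 1) * (1 - (3 / 4) ^ (v - k)) := rfl

lemma decreasingAmplitude_nonneg {q : ℝ} (hq : 0 < q) (k : ℕ) : 0 ≤ decreasingAmplitude q k := by
  unfold decreasingAmplitude
  positivity

lemma decreasingBound_nonneg {q : ℝ} (hq : 0 < q) (k v : ℕ) : 0 ≤ decreasingBound q k v := by
  cases k with
  | zero => exact zero_le_one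
  | succ k =>
    exact mul_nonneg (decreasingAmplitude_nonneg hq _)
      (sub_nonneg.2 (pow_le_one₀ (by norm_num) (by norm_num)))

lemma decreasingBound_le {q : ℝ} (hq : 0 < q) (k v : ℕ) :
    decreasingBound q k v ≤ decreasingAmplitude q k := by
  cases k with
  | zero => simp [decreasingBound, decreasingAmplitude]
  | succ k =>
    refine mul_le_of_le_one_right (decreasingAmplitude_nonneg hq _) ?_
    have : (0 : ℝ) ≤ (3 / 4) ^ (v - k) := by positivity
    linarith

lemma decreasingBound_eq_zero {q : ℝ} {k v : ℕ} (h : v < k) : decreasingBound q k v = 0 := by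
  cases k with
  | zero => omega
  | succ k => simp [decreasingBound, Nat.sub_eq_zero_of_le (Nat.lt_succ_iff.1 h)]

lemma sum_decreasingBound_le {q : ℝ} (hq : 0 < q) (k m : ℕ) :
    ∑ v ∈ Finset.range (k + m), decreasingBound q k v ≤ m * decreasingAmplitude q k := by
  rw [Finset.sum_range_add, Finset.sum_eq_zero fun v hv =>
    decreasingBound_eq_zero (Finset.mem_range.1 hv), zero_add]
  refine (Finset.sum_le_sum fun v _ => decreasingBound_le hq k (k + v)).trans ?_
  simp

lemma half_pow_mul_le (s : ℕ) :
    (1 / 2 : ℝ) ^ s * ((s + 1) / 24 + 1 / 4 * (1 - (3 / 4) ^ (s + 1))) ≤ (3 / 4) ^ s / 4 := by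
  have key : ∀ s : ℕ, (1 / 2 : ℝ) ^ (s + 1) * ((s + 1 + 1) / 24 + 1 / 4) ≤
      (3 / 4) ^ (s + 1) / 4 := by
    intro s
    induction s with
    | zero => norm_num
    | succ s ih =>
      rw [pow_succ _ (s + 1), pow_succ _ (s + 1)]
      push_cast
      have : (0 : ℝ) ≤ (1 / 2) ^ (s + 1) * (s + 1) := by positivity
      have : (0 : ℝ) ≤ (1 / 2) ^ (s + 1) := by positivity
      linarith
  cases s with
  | zero => norm_num
  | succ s =>
    refine le_trans ?_ (key s)
    push_cast
    refine mul_le_mul_of_nonneg_left ?_ (by positivity)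
    have : (0 : ℝ) ≤ (3 / 4) ^ (s + 1 + 1) := by positivity
    linarith

lemma decreasingBound_supersolution {q : ℝ} (hq : 0 < q) (hq2 : q < 1 / 2) (k w : ℕ) :
    q ^ w * ∑ v ∈ Finset.range w, decreasingBound q k v +
      q ^ (w + 1) * decreasingBound q (k + 1) w +
      (if 0 < w then decreasingBound q (k + 1) (w - 1) else 0) ≤ decreasingBound q (k + 1) w := by
  rcases Nat.lt_or_ge w (k + 1) with h | h
  · rw [Finset.sum_eq_zero fun v hv => decreasingBound_eq_zero
      ((Finset.mem_range.1 hv).trans_le (Nat.lt_succ_iff.1 h)), decreasingBound_eq_zero h,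
      decreasingBound_eq_zero (by omega : w - 1 < k + 1)]
    simp
  · obtain ⟨s, rfl⟩ := Nat.exists_eq_add_of_le h
    rw [if_pos (by omega)]
    have hsum := sum_decreasingBound_le hq k (s + 1)
    rw [show k + (s + 1) = k + 1 + s by ring] at hsum
    have hA := decreasingAmplitude_nonneg hq k
    have hr : (0 : ℝ) ≤ 1 - (3 / 4) ^ (s + 1) :=
      sub_nonneg.2 (pow_le_one₀ (by norm_num) (by norm_num))
    have hqs : q ^ s ≤ (1 / 2) ^ s := pow_le_pow_left₀ hq.le hq2.le s
    have hqk : q ^ (k + 2) ≤ 1 / 4 := calc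
      q ^ (k + 2) ≤ q ^ 2 := pow_le_pow_of_le_one hq.le (by linarith) (by omega)
      _ ≤ (1 / 2) ^ 2 := pow_le_pow_left₀ hq.le hq2.le 2
      _ = 1 / 4 := by norm_num
    have hmain : q ^ s * ((s + 1) / 24 + q ^ (k + 2) * (1 - (3 / 4) ^ (s + 1))) ≤
        (3 / 4) ^ s / 4 := by
      refine le_trans ?_ (half_pow_mul_le s)
      gcongr
    have hsum' := mul_le_mul_of_nonneg_left hsum (by positivity : 0 ≤ q ^ (k + 1 + s))
    have hmain' := mul_le_mul_of_nonneg_left hmain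
      (decreasingAmplitude_nonneg hq (k + 1))
    have hsucc := decreasingAmplitude_succ q k
    simp only [decreasingBound_succ, show k + 1 + s - k = s + 1 by omega,
      show k + 1 + s - 1 - k = s by omega]
    have e1 : q ^ (k + 1 + s) * (((s + 1 : ℕ) : ℝ) * decreasingAmplitude q k) =
        decreasingAmplitude q (k + 1) * (q ^ s * ((s + 1) / 24)) := by
      rw [hsucc, pow_add]
      push_cast
      ring
    have e2 : q ^ (k + 1 + s + 1) = q ^ s * q ^ (k + 2) := by
      rw [← pow_add]
      congr 1
      ring
    have e3 : (3 / 4 : ℝ) ^ (s + 1) = (3 / 4) ^ s * (3 / 4) := pow_succ _ _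
    rw [e1] at hsum'
    rw [e2]
    rw [e3] at hmain' ⊢
    linarith

lemma decreasingWeight_le_bound {q : ℝ} (hq : 0 < q) (hq2 : q < 1 / 2) (n k v : ℕ) :
    decreasingWeight n q k v ≤ decreasingBound q k v * mallowsZ n q := by
  induction n generalizing k v with
  | zero =>
    refine le_trans (Finset.sum_nonpos fun σ _ => ?_)
      (mul_nonneg (decreasingBound_nonneg hq k v) (mallowsZ_pos 0 hq).le)
    rw [if_neg]
    rintro ⟨f, -⟩
    exact (f 0).elim0
  | succ n ih =>
    cases k with
    | zero => simpa [decreasingBound] using decreasingWeight_le (n + 1) hq 0 v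
    | succ k =>
      refine (decreasingWeight_succ_le_mul n hq k v).trans ?_
      rw [mallowsZ_succ, mul_left_comm]
      refine mul_le_mul_of_nonneg_left ?_ (by positivity)
      refine le_trans ?_ (mul_le_mul_of_nonneg_right (decreasingBound_supersolution hq hq2 k v)
        (mallowsZ_pos n hq).le)
      rw [add_mul, add_mul, mul_assoc, mul_assoc, Finset.sum_mul, ite_mul, zero_mul]
      gcongr
      · exact ih _ _
      · exact ih _ _
      · split_ifs
        · exact ih _ _
        · exact le_rfl

lemma exists_hasDecreasingFrom_of_lt_LDS {n k : ℕ} {π : Equiv.Perm (Fin n)} (h : k < LDS π) :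
    ∃ v < n, HasDecreasingFrom k π v := by
  have hne : {m | ∃ f : Fin m → Fin n, StrictMono f ∧ StrictAnti (fun j => π (f j))}.Nonempty :=
    ⟨0, fun j => j.elim0, fun j => j.elim0, fun j => j.elim0⟩
  obtain ⟨m, ⟨f, hf, hanti⟩, hm⟩ := exists_lt_of_lt_csSup hne h
  have hc : StrictMono (Fin.castLE (Nat.succ_le_of_lt hm)) := Fin.strictMono_castLE _
  exact ⟨_, Fin.isLt _, fun j => f (Fin.castLE (Nat.succ_le_of_lt hm) j), hf.comp hc,
    hanti.comp_strictMono hc, rfl⟩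

lemma mallowsProb_lt_LDS_le {q : ℝ} (hq : 0 < q) (n k : ℕ) :
    mallowsProb n q {π | k < LDS π} ≤
      ∑ v ∈ Finset.range n, decreasingWeight n q k v / mallowsZ n q := by
  classical
  have hZ := mallowsZ_pos n hq
  rw [← Finset.sum_div, mallowsProb, le_div_iff₀ hZ, Finset.sum_mul]
  simp only [decreasingWeight]
  rw [Finset.sum_comm]
  refine Finset.sum_le_sum fun π _ => ?_
  have hterm : ∀ v ∈ Finset.range n,
      0 ≤ if HasDecreasingFrom k π v then q ^ mallowsInv π else 0 :=
    fun v _ => by split_ifs <;> positivity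
  by_cases h : k < LDS π
  · obtain ⟨v, hv, hd⟩ := exists_hasDecreasingFrom_of_lt_LDS h
    rw [Set.indicator_of_mem (by exact h)]
    refine le_trans (le_of_eq ?_) (Finset.single_le_sum hterm (Finset.mem_range.2 hv))
    rw [if_pos hd]
    exact div_mul_cancel₀ _ hZ.ne'
  · rw [Set.indicator_of_notMem (by exact h), zero_mul]
    exact Finset.sum_nonneg hterm

/-- There is an absolute constant `C>0` so that for `n≥2`, `0<q<1/2` and
integer `L≥2`, if `π ~ μ_{n,q}` then `P(LDS(π) ≥ L) ≤ n·C^L·q^{L(L−1)/2}`. -/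
theorem mallows_LDS_upper_tail_small_q :
    ∃ C : ℝ, 0 < C ∧
      ∀ (n : ℕ) (q : ℝ) (L : ℕ), 2 ≤ n → 0 < q → q < 1 / 2 → 2 ≤ L →
        mallowsProb n q {π | L ≤ LDS π} ≤ (n : ℝ) * C ^ L * q ^ (L * (L - 1) / 2) := by
  refine ⟨24, by norm_num, fun n q L _ hq hq2 hL => ?_⟩
  obtain ⟨k, rfl⟩ := Nat.exists_eq_add_of_le' (one_le_two.trans hL)
  calc mallowsProb n q {π | k + 1 ≤ LDS π}
      ≤ ∑ v ∈ Finset.range n, decreasingWeight n q k v / mallowsZ n q :=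
        mallowsProb_lt_LDS_le hq n k
    _ ≤ ∑ _v ∈ Finset.range n, decreasingAmplitude q k :=
        Finset.sum_le_sum fun v _ => ((div_le_iff₀ (mallowsZ_pos n hq)).2
          (decreasingWeight_le_bound hq hq2 n k v)).trans (decreasingBound_le hq k v)
    _ = n * 24 ^ k * q ^ ((k + 1) * k / 2) := by
        simp [decreasingAmplitude, mul_assoc]
    _ ≤ n * 24 ^ (k + 1) * q ^ ((k + 1) * (k + 1 - 1) / 2) := by
        rw [Nat.add_sub_cancel]
        gcongr
        · norm_num
        · exact k.le_succ
end
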